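/- arXiv:1407.0559 — 2 statements merged into one kernel-verified Lean document; each statement's English description precedes it below -/
import Mathlib

section
/- Let R be a commutative Noetherian ring, a an ideal of R, M a finitely generated R-module, and s, n non-negative integers. If x_1, ..., x_s ∈ a is an M-regular sequence, then f_a^n(M) ≤ s + f_a^n(M/(x_1,...,x_s)M). -/
open CategoryTheory

noncomputable section

/-- An `R`-module `M` is *in dimension `< n`* if there exists a finitely generated
submodule `N ⊆ M` such that `dim Supp (M/N) < n`. -/
def InDimLT (R : Type) [CommRing R] (M : Type) [AddCommGroup M] [Module R M] (n : ℕ) : Prop :=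
  ∃ N : Submodule R M, N.FG ∧ Order.krullDim (Module.support R (M ⧸ N)) < (n : WithBot ℕ∞)

/-- The `i`-th local cohomology module of `M` with support in the ideal `a`. -/
def locCoh (R : Type) [CommRing R] (a : Ideal R) (i : ℕ)
    (M : Type) [AddCommGroup M] [Module R M] : ModuleCat R :=
  (localCohomology a i).obj (ModuleCat.of R M)

/-- The finiteness dimension `f_a(M)`:  the least `i` such that `H^i_a(M)` is not
finitely generated (`∞` if there is no such `i`). -/
def finDim (R : Type) [CommRing R] (a : Ideal R)
    (M : Type) [AddCommGroup M] [Module R M] : ℕ∞ :=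
  sInf (Nat.cast '' {i : ℕ | ¬ Module.Finite R ↥(locCoh R a i M)})

/-- The `n`-th finiteness dimension `f_a^n(M)`. -/
def finDimN (R : Type) [CommRing R] (a : Ideal R) (n : ℕ)
    (M : Type) [AddCommGroup M] [Module R M] : ℕ∞ :=
  sInf {d : ℕ∞ | ∃ p : PrimeSpectrum R,
    p ∈ Module.support R (M ⧸ (a • ⊤ : Submodule R M)) ∧
    (n : WithBot ℕ∞) ≤ ringKrullDim (R ⧸ p.asIdeal) ∧
    d = finDim (Localization.AtPrime p.asIdeal)
      (a.map (algebraMap R (Localization.AtPrime p.asIdeal)))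
      (LocalizedModule p.asIdeal.primeCompl M)}

/-- `h_a^n(M)`: the least `i` such that `H^i_a(M)` is not in dimension `< n`. -/
def hDimN (R : Type) [CommRing R] (a : Ideal R) (n : ℕ)
    (M : Type) [AddCommGroup M] [Module R M] : ℕ∞ :=
  sInf (Nat.cast '' {i : ℕ | ¬ InDimLT R ↥(locCoh R a i M) n})

namespace CategoryTheory.Functor

open Limits

variable {C D : Type*} [Category* C] [Category* D] [Abelian C]
  [Abelian D] (T : ShortComplex (C ⥤ D)) [T.X₁.Additive] [T.X₂.Additive] [T.X₃.Additive]

/-- A short complex of additive functors applied to a chain complex. -/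
def mapChainComplexShortComplex (K : ChainComplex C ℕ) : ShortComplex (ChainComplex D ℕ) where
  X₁ := (T.X₁.mapHomologicalComplex _).obj K
  X₂ := (T.X₂.mapHomologicalComplex _).obj K
  X₃ := (T.X₃.mapHomologicalComplex _).obj K
  f := (NatTrans.mapHomologicalComplex T.f _).app K
  g := (NatTrans.mapHomologicalComplex T.g _).app K
  zero := by
    ext i
    exact congr_app T.zero (K.X i)

/-- The functoriality of `mapChainComplexShortComplex` in the chain complex. -/
def mapChainComplexShortComplexMap {K L : ChainComplex C ℕ} (φ : K ⟶ L) :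
    mapChainComplexShortComplex T K ⟶ mapChainComplexShortComplex T L where
  τ₁ := (T.X₁.mapHomologicalComplex _).map φ
  τ₂ := (T.X₂.mapHomologicalComplex _).map φ
  τ₃ := (T.X₃.mapHomologicalComplex _).map φ
  comm₁₂ := (NatTrans.mapHomologicalComplex T.f _).naturality φ
  comm₂₃ := (NatTrans.mapHomologicalComplex T.g _).naturality φ

variable {T}

lemma mapChainComplexShortComplex_shortExact
    (hT : ∀ X : C, Projective X → (T.map ((evaluation C D).obj X)).ShortExact)
    {X : C} (P : ProjectiveResolution X) :
    (mapChainComplexShortComplex T P.complex).ShortExact :=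
  HomologicalComplex.shortExact_of_degreewise_shortExact _
    fun i => hT (P.complex.X i) (P.projective i)

/-- The connecting morphism of the homology sequence of `mapChainComplexShortComplex T P.complex`,
with source and target as in `ProjectiveResolution.isoLeftDerivedObj`. -/
def mapResolutionδ (hT : ∀ X : C, Projective X → (T.map ((evaluation C D).obj X)).ShortExact)
    {X : C} (P : ProjectiveResolution X) (n : ℕ) :
    (HomologicalComplex.homologyFunctor D _ (n + 1)).obj
      ((T.X₃.mapHomologicalComplex (ComplexShape.down ℕ)).obj P.complex) ⟶
    (HomologicalComplex.homologyFunctor D _ n).obj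
      ((T.X₁.mapHomologicalComplex (ComplexShape.down ℕ)).obj P.complex) :=
  (mapChainComplexShortComplex_shortExact hT P).δ (n + 1) n (by simp)

lemma mapResolutionδ_naturality
    (hT : ∀ X : C, Projective X → (T.map ((evaluation C D).obj X)).ShortExact)
    {X Y : C} (P : ProjectiveResolution X) (Q : ProjectiveResolution Y) (n : ℕ)
    (φ : P.complex ⟶ Q.complex) :
    mapResolutionδ hT P n ≫
        (T.X₁.mapHomologicalComplex _ ⋙ HomologicalComplex.homologyFunctor D _ n).map φ =
      (T.X₃.mapHomologicalComplex _ ⋙ HomologicalComplex.homologyFunctor D _ (n + 1)).map φ ≫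
        mapResolutionδ hT Q n :=
  HomologicalComplex.HomologySequence.δ_naturality (mapChainComplexShortComplexMap T φ)
    (mapChainComplexShortComplex_shortExact hT P) (mapChainComplexShortComplex_shortExact hT Q)
    (n + 1) n (by simp)

lemma mapResolutionδ_comp
    (hT : ∀ X : C, Projective X → (T.map ((evaluation C D).obj X)).ShortExact)
    {X : C} (P : ProjectiveResolution X) (n : ℕ) :
    mapResolutionδ hT P n ≫ (HomologicalComplex.homologyFunctor D _ n).map
      ((NatTrans.mapHomologicalComplex T.f (ComplexShape.down ℕ)).app P.complex) = 0 :=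
  (mapChainComplexShortComplex_shortExact hT P).δ_comp (n + 1) n (by simp)

lemma mapResolutionδ_exact
    (hT : ∀ X : C, Projective X → (T.map ((evaluation C D).obj X)).ShortExact)
    {X : C} (P : ProjectiveResolution X) (n : ℕ) :
    (ShortComplex.mk _ _ (mapResolutionδ_comp hT P n)).Exact :=
  (mapChainComplexShortComplex_shortExact hT P).homology_exact₁ (n + 1) n (by simp)

variable [HasProjectiveResolutions C]

/-- The connecting morphism between left derived functors attached to a sequence of functors
that is short exact on projective objects. -/
def leftDerivedδ (hT : ∀ X : C, Projective X → (T.map ((evaluation C D).obj X)).ShortExact)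
    (n : ℕ) : T.X₃.leftDerived (n + 1) ⟶ T.X₁.leftDerived n where
  app X := ((projectiveResolution X).isoLeftDerivedObj T.X₃ (n + 1)).hom ≫
    mapResolutionδ hT (projectiveResolution X) n ≫
    ((projectiveResolution X).isoLeftDerivedObj T.X₁ n).inv
  naturality X Y f := by
    have hf : (ProjectiveResolution.lift f (projectiveResolution X) (projectiveResolution Y)).f 0 ≫
        (projectiveResolution Y).π.f 0 = (projectiveResolution X).π.f 0 ≫ f := by
      rw [← HomologicalComplex.comp_f, ProjectiveResolution.lift_commutes,
        HomologicalComplex.comp_f, ChainComplex.single₀_map_f_zero]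
      rfl
    rw [ProjectiveResolution.isoLeftDerivedObj_hom_naturality_assoc f _ _ _ hf,
      Category.assoc, Category.assoc,
      ProjectiveResolution.isoLeftDerivedObj_inv_naturality f _ _ _ hf,
      ← Category.assoc (mapResolutionδ hT _ n), mapResolutionδ_naturality, Category.assoc]
    rfl

lemma leftDerivedδ_comp_app
    (hT : ∀ X : C, Projective X → (T.map ((evaluation C D).obj X)).ShortExact) (n : ℕ) (X : C) :
    (leftDerivedδ hT n).app X ≫ (NatTrans.leftDerived T.f n).app X = 0 := by
  rw [ProjectiveResolution.leftDerived_app_eq _ (projectiveResolution X)]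
  dsimp only [leftDerivedδ]
  simp only [Category.assoc, Iso.inv_hom_id_assoc]
  rw [← Category.assoc (mapResolutionδ hT _ n), mapResolutionδ_comp, zero_comp, comp_zero]

lemma leftDerivedδ_exact
    (hT : ∀ X : C, Projective X → (T.map ((evaluation C D).obj X)).ShortExact) (n : ℕ) (X : C) :
    (ShortComplex.mk _ _ (leftDerivedδ_comp_app hT n X)).Exact := by
  refine (ShortComplex.exact_iff_of_iso (ShortComplex.isoMk
    ((projectiveResolution X).isoLeftDerivedObj T.X₃ (n + 1))
    ((projectiveResolution X).isoLeftDerivedObj T.X₁ n)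
    ((projectiveResolution X).isoLeftDerivedObj T.X₂ n) ?_ ?_)).2
    (mapResolutionδ_exact hT (projectiveResolution X) n)
  · dsimp only [leftDerivedδ]
    simp only [Category.assoc, Iso.inv_hom_id, Category.comp_id]
  · dsimp only
    rw [ProjectiveResolution.leftDerived_app_eq _ (projectiveResolution X)]
    simp only [Category.assoc, Iso.inv_hom_id, Category.comp_id]

end CategoryTheory.Functor

namespace CategoryTheory

variable {R : Type*} [Ring R] {C : Type*} [Category* C] [Abelian C] [Linear R C]

/-- The short complex of functors `Hom(-, S)` attached to a short complex `S`, with values in the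
opposite category of modules. -/
def ShortComplex.linearYonedaRightOp (R : Type*) [Ring R] [Linear R C] (S : ShortComplex C) :
    ShortComplex (C ⥤ (ModuleCat R)ᵒᵖ) where
  X₁ := ((linearYoneda R C).obj S.X₃).rightOp
  X₂ := ((linearYoneda R C).obj S.X₂).rightOp
  X₃ := ((linearYoneda R C).obj S.X₁).rightOp
  f := NatTrans.rightOp ((linearYoneda R C).map S.g)
  g := NatTrans.rightOp ((linearYoneda R C).map S.f)
  zero := by
    ext X
    apply Quiver.Hom.unop_inj
    ext (φ : X ⟶ S.X₁)
    change (φ ≫ S.f) ≫ S.g = 0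
    simp

instance (S : ShortComplex C) : (S.linearYonedaRightOp R).X₁.Additive :=
  inferInstanceAs ((linearYoneda R C).obj S.X₃).rightOp.Additive

instance (S : ShortComplex C) : (S.linearYonedaRightOp R).X₂.Additive :=
  inferInstanceAs ((linearYoneda R C).obj S.X₂).rightOp.Additive

instance (S : ShortComplex C) : (S.linearYonedaRightOp R).X₃.Additive :=
  inferInstanceAs ((linearYoneda R C).obj S.X₁).rightOp.Additive

lemma ShortComplex.ShortExact.linearYonedaRightOp {S : ShortComplex C} (hS : S.ShortExact)
    (X : C) (hX : Projective X) :
    ((S.linearYonedaRightOp R).map ((evaluation C (ModuleCat R)ᵒᵖ).obj X)).ShortExact := by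
  have := hS.mono_f
  have := hS.epi_g
  refine (ShortComplex.shortExact_iff_unop _).2 ?_
  refine ShortComplex.ShortExact.mk' ?_ ?_ ?_
  · rw [ShortComplex.moduleCat_exact_iff]
    intro (φ : X ⟶ S.X₂) (hφ : φ ≫ S.g = 0)
    exact ⟨hS.fIsKernel.lift (Limits.KernelFork.ofι φ hφ), hS.fIsKernel.fac _ .zero⟩
  · rw [ModuleCat.mono_iff_injective]
    intro (φ : X ⟶ S.X₁) (ψ : X ⟶ S.X₁) (h : φ ≫ S.f = ψ ≫ S.f)
    exact (cancel_mono S.f).1 h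
  · rw [ModuleCat.epi_iff_surjective]
    intro (φ : X ⟶ S.X₃)
    exact ⟨Projective.factorThru φ S.g, Projective.factorThru_comp φ S.g⟩

/-- A short complex of functors is exact if it is pointwise exact. -/
lemma ShortComplex.exact_of_evaluation {J A : Type*} [Category* J] [Category* A] [Abelian A]
    (S : ShortComplex (J ⥤ A)) (h : ∀ j, (S.map ((evaluation J A).obj j)).Exact) : S.Exact := by
  rw [ShortComplex.exact_iff_isZero_homology]
  refine Functor.isZero _ fun j => ?_
  exact ((ShortComplex.exact_iff_isZero_homology _).1 (h j)).of_iso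
    (S.mapHomologyIso ((evaluation J A).obj j)).symm

end CategoryTheory

namespace localCohomology

open CategoryTheory Limits

variable {R : Type} [CommRing R] {D : Type} [SmallCategory D]

/-- The directed system `Ext^i(R/J, M)` whose colimit is local cohomology. -/
abbrev diagramAt (I : D ⥤ Ideal R) (i : ℕ) (M : ModuleCat R) : Dᵒᵖ ⥤ ModuleCat R :=
  diagram I i ⋙ (evaluation _ _).obj M

/-- Local cohomology of `M` as a cocone over `diagramAt`. -/
abbrev coconeAt (I : D ⥤ Ideal R) (i : ℕ) (M : ModuleCat R) : Cocone (diagramAt I i M) :=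
  ((evaluation _ _).obj M).mapCocone (colimit.cocone (diagram I i))

/-- The cocone `coconeAt` is a colimit cocone. -/
def isColimitCoconeAt (I : D ⥤ Ideal R) (i : ℕ) (M : ModuleCat R) :
    IsColimit (coconeAt I i M) :=
  isColimitOfPreserves _ (colimit.isColimit _)

/-- The connecting morphism on the directed systems of `Ext` modules. -/
def diagramAtδ (I : D ⥤ Ideal R) (i : ℕ) {S : ShortComplex (ModuleCat R)} (hS : S.ShortExact) :
    diagramAt I i S.X₃ ⟶ diagramAt I (i + 1) S.X₁ where
  app t := ((Functor.leftDerivedδ (hS.linearYonedaRightOp (R := R)) i).app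
    ((ringModIdeals I).obj t.unop)).unop
  naturality _ _ f := Quiver.Hom.op_inj
    ((Functor.leftDerivedδ (hS.linearYonedaRightOp (R := R)) i).naturality
      ((ringModIdeals I).map f.unop)).symm

/-- The map on directed systems of `Ext` modules induced by a map of modules. -/
abbrev diagramAtMap (I : D ⥤ Ideal R) (i : ℕ) {M N : ModuleCat R} (f : M ⟶ N) :
    diagramAt I i M ⟶ diagramAt I i N :=
  Functor.whiskerLeft _ ((evaluation _ _).map f)

/-- The short complex of directed systems of `Ext` modules. -/
def diagramAtShortComplex (I : D ⥤ Ideal R) (i : ℕ) {S : ShortComplex (ModuleCat R)}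
    (hS : S.ShortExact) : ShortComplex (Dᵒᵖ ⥤ ModuleCat R) where
  X₁ := diagramAt I i S.X₂
  X₂ := diagramAt I i S.X₃
  X₃ := diagramAt I (i + 1) S.X₁
  f := diagramAtMap I i S.g
  g := diagramAtδ I i hS
  zero := by
    ext1
    funext t
    exact Quiver.Hom.op_inj (Functor.leftDerivedδ_comp_app (hS.linearYonedaRightOp (R := R)) i
      ((ringModIdeals I).obj t.unop))

lemma diagramAtShortComplex_exact (I : D ⥤ Ideal R) (i : ℕ) {S : ShortComplex (ModuleCat R)}
    (hS : S.ShortExact) : (diagramAtShortComplex I i hS).Exact :=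
  ShortComplex.exact_of_evaluation _ fun t =>
    (Functor.leftDerivedδ_exact (hS.linearYonedaRightOp (R := R)) i
      ((ringModIdeals I).obj t.unop)).unop

/-- The connecting morphism in local cohomology fits in an exact sequence. -/
lemma exists_exact (J : Ideal R) (i : ℕ) {S : ShortComplex (ModuleCat R)} (hS : S.ShortExact) :
    ∃ (f : (localCohomology J i).obj S.X₂ ⟶ (localCohomology J i).obj S.X₃)
      (g : (localCohomology J i).obj S.X₃ ⟶ (localCohomology J (i + 1)).obj S.X₁)
      (w : f ≫ g = 0), (ShortComplex.mk f g w).Exact := by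
  let I := idealPowersDiagram J
  have := colim.exact_mapShortComplex (diagramAtShortComplex_exact I i hS)
    (isColimitCoconeAt I i S.X₂) (isColimitCoconeAt I i S.X₃) (isColimitCoconeAt I (i + 1) S.X₁)
    ((isColimitCoconeAt I i S.X₂).map (coconeAt I i S.X₃) (diagramAtShortComplex I i hS).f)
    ((isColimitCoconeAt I i S.X₃).map (coconeAt I (i + 1) S.X₁) (diagramAtShortComplex I i hS).g)
    (fun j => IsColimit.ι_map _ _ _ _) (fun j => IsColimit.ι_map _ _ _ _)
  exact ⟨_, _, _, this⟩

end localCohomology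

section FinDim

variable (R : Type) [CommRing R] (a : Ideal R)

lemma finDim_congr {M N : Type} [AddCommGroup M] [Module R M] [AddCommGroup N] [Module R N]
    (e : M ≃ₗ[R] N) : finDim R a M = finDim R a N := by
  have h (i : ℕ) : Module.Finite R (locCoh R a i M) ↔ Module.Finite R (locCoh R a i N) :=
    Module.Finite.equiv_iff ((localCohomology a i).mapIso e.toModuleIso).toLinearEquiv
  simp only [finDim, h]

variable {R a} in
lemma finDim_le_of_not_finite {M : Type} [AddCommGroup M] [Module R M] {i : ℕ}
    (h : ¬ Module.Finite R (locCoh R a i M)) : finDim R a M ≤ i :=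
  sInf_le ⟨i, h, rfl⟩

variable [IsNoetherianRing R]

lemma finite_locCoh_quotSMulTop {M : Type} [AddCommGroup M] [Module R M] {x : R}
    (hx : IsSMulRegular M x) (i : ℕ) [Module.Finite R (locCoh R a i M)]
    [Module.Finite R (locCoh R a (i + 1) M)] :
    Module.Finite R (locCoh R a i (QuotSMulTop x M)) := by
  have hS : ((ModuleCat.of R M).smulShortComplex x).ShortExact :=
    IsSMulRegular.smulShortComplex_shortExact hx
  obtain ⟨f, g, w, h⟩ := localCohomology.exists_exact a i hS
  have : IsNoetherian R ((localCohomology a i).obj ((ModuleCat.of R M).smulShortComplex x).X₂) :=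
    isNoetherian_of_isNoetherianRing_of_finite R (locCoh R a i M)
  have : IsNoetherian R
      ((localCohomology a (i + 1)).obj ((ModuleCat.of R M).smulShortComplex x).X₁) :=
    isNoetherian_of_isNoetherianRing_of_finite R (locCoh R a (i + 1) M)
  have : IsNoetherian R ((localCohomology a i).obj ((ModuleCat.of R M).smulShortComplex x).X₃) :=
    isNoetherian_of_range_eq_ker f.hom g.hom (ShortComplex.Exact.moduleCat_range_eq_ker h)
  exact Module.IsNoetherian.finite R
    ((localCohomology a i).obj ((ModuleCat.of R M).smulShortComplex x).X₃)

lemma finDim_le_one_add_quotSMulTop (M : Type) [AddCommGroup M] [Module R M] {x : R}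
    (hx : IsSMulRegular M x) : finDim R a M ≤ 1 + finDim R a (QuotSMulTop x M) := by
  by_contra! hlt
  have hne : finDim R a (QuotSMulTop x M) ≠ ⊤ := fun h => by simp [h] at hlt
  have hmem : finDim R a (QuotSMulTop x M) ∈
      Nat.cast '' {i : ℕ | ¬ Module.Finite R (locCoh R a i (QuotSMulTop x M))} := by
    refine csInf_mem (Set.nonempty_iff_ne_empty.2 fun h => hne ?_)
    rw [finDim, h, sInf_empty]
  obtain ⟨i, hi, hi'⟩ := hmem
  rw [← hi'] at hlt
  have h₀ : Module.Finite R (locCoh R a i M) := by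
    by_contra h
    exact absurd (hlt.trans_le (finDim_le_of_not_finite h)) (not_lt.2 le_add_self)
  have h₁ : Module.Finite R (locCoh R a (i + 1) M) := by
    by_contra h
    exact absurd (hlt.trans_le (finDim_le_of_not_finite h)) (by push_cast; simp [add_comm])
  exact hi (finite_locCoh_quotSMulTop R a hx i)

lemma finDim_le_length_add (M : Type) [AddCommGroup M] [Module R M] (rs : List R)
    (hrs : RingTheory.Sequence.IsWeaklyRegular M rs) :
    finDim R a M ≤ rs.length + finDim R a (M ⧸ (Ideal.ofList rs • ⊤ : Submodule R M)) := by
  induction rs generalizing M with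
  | nil =>
    have h : (Ideal.ofList ([] : List R) • ⊤ : Submodule R M) = ⊥ := by simp
    simp [← finDim_congr R a (Submodule.quotEquivOfEqBot _ h).symm]
  | cons x rs ih =>
    rw [RingTheory.Sequence.isWeaklyRegular_cons_iff] at hrs
    rw [finDim_congr R a (Submodule.quotOfListConsSMulTopEquivQuotSMulTopInner M x rs),
      List.length_cons, Nat.cast_succ, add_comm (rs.length : ℕ∞), add_assoc]
    exact (finDim_le_one_add_quotSMulTop R a M hrs.1).trans (by gcongr; exact ih _ hrs.2)

end FinDim

/-- Localization commutes with the formation of `M ⧸ I M`. -/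
def localizedQuotientSMulTopEquiv {R M : Type*} [CommRing R] [AddCommGroup M] [Module R M]
    (p : Submonoid R) (I : Ideal R) :
    (LocalizedModule p M ⧸ (I.map (algebraMap R (Localization p)) • ⊤ :
      Submodule (Localization p) (LocalizedModule p M))) ≃ₗ[Localization p]
      LocalizedModule p (M ⧸ (I • ⊤ : Submodule R M)) :=
  Submodule.quotEquivOfEq _ _ (by
    rw [Submodule.localized, Submodule.localized'_smul, Submodule.localized'_top,
      Submodule.localized'_eq_span]
    rfl) ≪≫ₗ localizedQuotientEquiv p (I • ⊤ : Submodule R M)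

lemma support_quotient_smul_quotient_smul {R M : Type*} [CommRing R] [AddCommGroup M] [Module R M]
    [Module.Finite R M] {I a : Ideal R} (h : I ≤ a) :
    Module.support R ((M ⧸ (I • ⊤ : Submodule R M)) ⧸
      (a • ⊤ : Submodule R (M ⧸ (I • ⊤ : Submodule R M)))) =
    Module.support R (M ⧸ (a • ⊤ : Submodule R M)) := by
  rw [Module.support_quotient, Module.support_quotient, Module.support_quotient, Set.inter_assoc,
    Set.inter_eq_right.2 (PrimeSpectrum.zeroLocus_anti_mono_ideal h)]

/-- If `x_1, …, x_s ∈ a` is an `M`-regular sequence, then for every `n`,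
`f_a^n(M) ≤ s + f_a^n(M/(x_1,…,x_s)M)`. -/
theorem finDimN_le_of_isRegular (R : Type) [CommRing R] [IsNoetherianRing R] (a : Ideal R)
    (M : Type) [AddCommGroup M] [Module R M] [Module.Finite R M]
    (s n : ℕ) (rs : List R) (hlen : rs.length = s) (hmem : ∀ x ∈ rs, x ∈ a)
    (hreg : RingTheory.Sequence.IsRegular M rs) :
    finDimN R a n M ≤ (s : ℕ∞) + finDimN R a n (M ⧸ (Ideal.ofList rs • ⊤ : Submodule R M)) := by
  subst hlen
  have hI : Ideal.ofList rs ≤ a := Ideal.span_le.2 hmem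
  conv_rhs => rw [finDimN]
  rw [ENat.add_sInf]
  refine le_iInf₂ fun d hd => ?_
  obtain ⟨p, hp, hn, rfl⟩ := hd
  rw [support_quotient_smul_quotient_smul hI] at hp
  refine (sInf_le ⟨p, hp, hn, rfl⟩ : finDimN R a n M ≤ _).trans ?_
  have h := finDim_le_length_add (Localization.AtPrime p.asIdeal)
    (a.map (algebraMap R (Localization.AtPrime p.asIdeal)))
    (LocalizedModule p.asIdeal.primeCompl M) _
    (hreg.toIsWeaklyRegular.of_isLocalizedModule (Localization.AtPrime p.asIdeal)
      p.asIdeal.primeCompl (LocalizedModule.mkLinearMap p.asIdeal.primeCompl M))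
  rwa [List.length_map, ← Ideal.map_ofList, finDim_congr _ _
    (localizedQuotientSMulTopEquiv p.asIdeal.primeCompl (Ideal.ofList rs))] at h
end
end

section
/- Let R be a commutative Noetherian ring, a an ideal of R, and M a finitely generated R-module. Then h_a^1(M) = inf{ i ≥ 0 : H^i_a(M) is not a minimax R-module }. -/
open CategoryTheory

noncomputable section

/-- An `R`-module `M` is *minimax* if it has a finitely generated submodule `N`
such that `M/N` is Artinian. -/
def IsMinimax (R : Type) [CommRing R] (M : Type) [AddCommGroup M] [Module R M] : Prop :=
  ∃ N : Submodule R M, N.FG ∧ IsArtinian R (M ⧸ N)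

namespace DerivedExt

variable {R : Type} [CommRing R]

/-- The complex `Hom(P, Y)` attached to a projective resolution, in the opposite category. -/
abbrev homComplex {X : ModuleCat.{0} R} (P : ProjectiveResolution X) (Y : ModuleCat.{0} R) :
    ChainComplex (ModuleCat.{0} R)ᵒᵖ ℕ :=
  (((linearYoneda R (ModuleCat.{0} R)).obj Y).rightOp.mapHomologicalComplex _).obj P.complex

abbrev cocycles {X : ModuleCat.{0} R} (P : ProjectiveResolution X) (Y : ModuleCat.{0} R) (n : ℕ) :
    ModuleCat.{0} R := ((homComplex P Y).opcycles n).unop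

def cocyclesIncl {X : ModuleCat.{0} R} (P : ProjectiveResolution X) (Y : ModuleCat.{0} R) (n : ℕ) :
    cocycles P Y n →ₗ[R] (P.complex.X n ⟶ Y) :=
  ((homComplex P Y).pOpcycles n).unop.hom

/-- The identification of the derived functor with the homology of `homComplex P Y`. -/
def isoHomology {X : ModuleCat.{0} R} (P : ProjectiveResolution X) (Y : ModuleCat.{0} R) (n : ℕ) :
    (((linearYoneda R (ModuleCat.{0} R)).obj Y).rightOp.leftDerived n).obj X ≅
      (homComplex P Y).homology n :=
  P.isoLeftDerivedObj ((linearYoneda R (ModuleCat.{0} R)).obj Y).rightOp n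

def cocyclesClass {X : ModuleCat.{0} R} (P : ProjectiveResolution X) (Y : ModuleCat.{0} R) (n : ℕ) :
    cocycles P Y n →ₗ[R] ((Ext R (ModuleCat.{0} R) n).obj (Opposite.op X)).obj Y :=
  ((isoHomology P Y n).hom ≫ (homComplex P Y).homologyι n).unop.hom

variable {X : ModuleCat.{0} R} (P : ProjectiveResolution X) (Y : ModuleCat.{0} R) (n : ℕ)

lemma cocyclesIncl_injective : Function.Injective (cocyclesIncl P Y n) :=
  (ModuleCat.mono_iff_injective ((homComplex P Y).pOpcycles n).unop).1 inferInstance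

lemma cocyclesClass_surjective : Function.Surjective (cocyclesClass P Y n) := by
  have : Mono ((isoHomology P Y n).hom ≫ (homComplex P Y).homologyι n) := mono_comp _ _
  exact (ModuleCat.epi_iff_surjective _).1 (inferInstance : Epi
    ((isoHomology P Y n).hom ≫ (homComplex P Y).homologyι n).unop)

lemma d_comp_cocyclesIncl (z : cocycles P Y n) (m : ℕ) :
    P.complex.d m n ≫ cocyclesIncl P Y n z = 0 := by
  have h := (homComplex P Y).d_pOpcycles m n
  have h2 := congrArg (fun f => f.unop.hom z) h
  exact h2

lemma exists_cocycle (f : P.complex.X n ⟶ Y) (hf : P.complex.d (n + 1) n ≫ f = 0) :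
    ∃ z, cocyclesIncl P Y n z = f := by
  let k : ModuleCat.of R R ⟶ ((homComplex P Y).X n).unop :=
    ModuleCat.ofHom (LinearMap.toSpanSingleton R (P.complex.X n ⟶ Y) f)
  have hk : (homComplex P Y).d (n + 1) n ≫ k.op = 0 := by
    apply Quiver.Hom.unop_inj
    ext
    change P.complex.d (n + 1) n ≫ ((1 : R) • f) = 0
    rw [one_smul, hf]
  refine ⟨((homComplex P Y).descOpcycles k.op (n + 1) (by simp) hk).unop.hom (1 : R), ?_⟩
  have h := (homComplex P Y).p_descOpcycles k.op (n + 1) (by simp) hk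
  have h2 := congrArg (fun f => f.unop.hom (1 : R)) h
  exact h2.trans (one_smul R f)

lemma cocyclesClass_eq_zero_iff_homologyι (z : cocycles P Y n) :
    cocyclesClass P Y n z = 0 ↔ ((homComplex P Y).homologyι n).unop.hom z = 0 := by
  have : Function.Injective (isoHomology P Y n).hom.unop.hom :=
    (ModuleCat.mono_iff_injective _).1 inferInstance
  exact this.eq_iff' (map_zero _)

lemma cocyclesClass_eq_zero_iff (z : cocycles P Y (n + 1)) :
    cocyclesClass P Y (n + 1) z = 0 ↔
      ∃ g : P.complex.X n ⟶ Y, P.complex.d (n + 1) n ≫ g = cocyclesIncl P Y (n + 1) z := by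
  rw [cocyclesClass_eq_zero_iff_homologyι]
  let K := homComplex P Y
  have hp : ∀ g : P.complex.X n ⟶ Y, cocyclesIncl P Y (n + 1)
      ((K.fromOpcycles (n + 1) n).unop.hom g) = P.complex.d (n + 1) n ≫ g := fun g =>
    congrArg (fun f => f.unop.hom g) (K.p_fromOpcycles (n + 1) n)
  have hex : (ShortComplex.mk _ _ (K.homologyι_comp_fromOpcycles (n + 1) n)).Exact :=
    ShortComplex.exact_of_f_is_kernel _ (K.homologyIsKernel (n + 1) n (by simp))
  have hex' := (ShortComplex.moduleCat_exact_iff _).1 hex.unop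
  constructor
  · intro h
    obtain ⟨g, hg⟩ := hex' z h
    exact ⟨g, (hp g).symm.trans (congrArg _ hg)⟩
  · rintro ⟨g, hg⟩
    rw [← hp] at hg
    rw [← cocyclesIncl_injective P Y (n + 1) hg]
    exact congrArg (fun f => f.unop.hom g) (K.homologyι_comp_fromOpcycles (n + 1) n)

lemma cocyclesClass_zero_eq_zero_iff (z : cocycles P Y 0) :
    cocyclesClass P Y 0 z = 0 ↔ cocyclesIncl P Y 0 z = 0 := by
  rw [cocyclesClass_eq_zero_iff_homologyι, (cocyclesIncl_injective P Y 0).eq_iff' (map_zero _)]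
  have : Function.Injective ((homComplex P Y).homologyι 0).unop.hom :=
    (ModuleCat.mono_iff_injective _).1 inferInstance
  exact this.eq_iff' (map_zero _)

lemma extMk_zero_eq_zero_iff (f : P.complex.X 0 ⟶ Y) (hf : P.complex.d 1 0 ≫ f = 0) :
    P.extMk f 1 rfl hf = 0 ↔ f = 0 := by
  refine ⟨fun h => ?_, fun h => by subst h; simp⟩
  rw [← P.extEquivCohomologyClass.apply_eq_iff_eq,
    ProjectiveResolution.extEquivCohomologyClass_extMk,
    ProjectiveResolution.extEquivCohomologyClass_zero,
    CochainComplex.HomComplex.CohomologyClass.mk_eq_zero_iff,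
    CochainComplex.HomComplex.Cocycle.toSingleMk_mem_coboundaries_iff _ _ _ _ _ 1 (by simp)] at h
  obtain ⟨g, hg⟩ := h
  have hz : Limits.IsZero (P.cochainComplex.X 1) :=
    CochainComplex.isZero_of_isStrictlyLE P.cochainComplex 0 1 (by simp)
  rw [hz.eq_of_src g 0, Limits.comp_zero] at hg
  rw [← cancel_epi (P.cochainComplexXIso (-(0 : ℕ)) 0 rfl).hom, Limits.comp_zero]
  exact hg.symm

/-- The cocycle `z`, viewed as an element of the derived `Ext`. -/
def cocyclesExt : cocycles P Y n →ₗ[R] Abelian.Ext X Y n where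
  toFun z := P.extMk (cocyclesIncl P Y n z) (n + 1) rfl (d_comp_cocyclesIncl P Y n z _)
  map_add' x y := by
    rw [P.add_extMk]
    congr 1
    exact map_add _ _ _
  map_smul' r x := by
    rw [RingHom.id_apply, Abelian.Ext.smul_eq_comp_mk₀, P.extMk_comp_mk₀]
    congr 1
    rw [map_smul]
    ext
    simp

lemma cocyclesExt_surjective : Function.Surjective (cocyclesExt P Y n) := by
  intro α
  obtain ⟨f, hf, rfl⟩ := P.extMk_surjective α (n + 1) rfl
  obtain ⟨z, rfl⟩ := exists_cocycle P Y n f hf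
  exact ⟨z, rfl⟩

lemma ker_cocyclesExt : LinearMap.ker (cocyclesExt P Y n) = LinearMap.ker (cocyclesClass P Y n) := by
  ext z
  rw [LinearMap.mem_ker, LinearMap.mem_ker]
  cases n with
  | zero =>
    rw [cocyclesClass_zero_eq_zero_iff]
    exact extMk_zero_eq_zero_iff P Y _ (d_comp_cocyclesIncl P Y 0 z 1)
  | succ n =>
    rw [cocyclesClass_eq_zero_iff]
    exact P.extMk_eq_zero_iff (cocyclesIncl P Y (n+1) z) (n+1+1) rfl (d_comp_cocyclesIncl P Y (n+1) z _) n rfl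

/-- The comparison between `Ext` defined with left derived functors and the `Ext` of the derived
category. -/
def extEquiv : ((Ext R (ModuleCat.{0} R) n).obj (Opposite.op X)).obj Y ≃ₗ[R] Abelian.Ext X Y n :=
  ((cocyclesClass P Y n).quotKerEquivOfSurjective (cocyclesClass_surjective P Y n)).symm ≪≫ₗ
    Submodule.quotEquivOfEq _ _ (ker_cocyclesExt P Y n).symm ≪≫ₗ
    (cocyclesExt P Y n).quotKerEquivOfSurjective (cocyclesExt_surjective P Y n)

lemma extEquiv_cocyclesClass (z : cocycles P Y n) :
    extEquiv P Y n (cocyclesClass P Y n z) = cocyclesExt P Y n z := by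
  have : ((cocyclesClass P Y n).quotKerEquivOfSurjective (cocyclesClass_surjective P Y n)).symm
      (cocyclesClass P Y n z) = Submodule.Quotient.mk z := by
    rw [LinearEquiv.symm_apply_eq]; rfl
  simp only [extEquiv, LinearEquiv.trans_apply, this]
  rfl

lemma extEquiv_naturality {X' : ModuleCat.{0} R} (P' : ProjectiveResolution X') (g : X' ⟶ X)
    (x : ((Ext R (ModuleCat.{0} R) n).obj (Opposite.op X)).obj Y) :
    extEquiv P' Y n ((((Ext R (ModuleCat.{0} R) n).map g.op).app Y).hom x) =
      (Abelian.Ext.mk₀ g).comp (extEquiv P Y n x) (zero_add n) := by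
  obtain ⟨z, rfl⟩ := cocyclesClass_surjective P Y n x
  let φ : ProjectiveResolution.Hom P' P g :=
    ⟨ProjectiveResolution.lift g P' P,
      (ProjectiveResolution.lift_commutes_zero _ _ _).trans (by simp)⟩
  let F := ((linearYoneda R (ModuleCat.{0} R)).obj Y).rightOp
  let Kφ := (F.mapHomologicalComplex (ComplexShape.down ℕ)).map φ.hom
  let z' : cocycles P' Y n := (HomologicalComplex.opcyclesMap Kφ n).unop.hom z
  have h1 : cocyclesIncl P' Y n z' = φ.hom.f n ≫ cocyclesIncl P Y n z :=
    congrArg (fun f => f.unop.hom z) (HomologicalComplex.p_opcyclesMap Kφ n)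
  have h2 : ((Ext R (ModuleCat.{0} R) n).map g.op).app Y (cocyclesClass P Y n z) =
      cocyclesClass P' Y n z' := by
    have h : (F.leftDerived n).map g ≫ (isoHomology P Y n).hom =
        (isoHomology P' Y n).hom ≫ HomologicalComplex.homologyMap Kφ n :=
      ProjectiveResolution.isoLeftDerivedObj_hom_naturality g P' P φ.hom
        (ProjectiveResolution.lift_commutes_zero _ _ _) F n
    have h3 : (F.leftDerived n).map g ≫ (isoHomology P Y n).hom ≫ (homComplex P Y).homologyι n =
        ((isoHomology P' Y n).hom ≫ (homComplex P' Y).homologyι n) ≫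
          HomologicalComplex.opcyclesMap Kφ n := by
      rw [reassoc_of% h, Category.assoc, HomologicalComplex.homologyι_naturality]
    exact congrArg (fun f => f.unop.hom z) h3
  refine (congrArg _ h2).trans ?_
  rw [extEquiv_cocyclesClass, extEquiv_cocyclesClass]
  simp only [cocyclesExt, LinearMap.coe_mk, AddHom.coe_mk]
  rw [ProjectiveResolution.mk₀_comp_extMk _ _ _ _ φ]
  congr 1

end DerivedExt

/-- `H` is the direct limit of the system `A`. -/
structure IsDirLim {R : Type} [CommRing R] {A : ℕ → Type} [∀ n, AddCommGroup (A n)]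
    [∀ n, Module R (A n)] (t : ∀ ⦃n m : ℕ⦄, n ≤ m → A n →ₗ[R] A m)
    {H : Type} [AddCommGroup H] [Module R H] (φ : ∀ n, A n →ₗ[R] H) : Prop where
  compat : ∀ ⦃n m : ℕ⦄ (h : n ≤ m) (x : A n), φ m (t h x) = φ n x
  surj : ∀ y : H, ∃ n x, φ n x = y
  ker : ∀ (n : ℕ) (x : A n), φ n x = 0 → ∃ (m : ℕ) (h : n ≤ m), t h x = 0

namespace IsDirLim
variable {R : Type} [CommRing R] {A : ℕ → Type} [∀ n, AddCommGroup (A n)]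
    [∀ n, Module R (A n)] {t : ∀ ⦃n m : ℕ⦄, n ≤ m → A n →ₗ[R] A m}
    {H : Type} [AddCommGroup H] [Module R H] {φ : ∀ n, A n →ₗ[R] H}

lemma nonempty_directLimit_equiv (hφ : IsDirLim t φ) :
    Nonempty (Module.DirectLimit A (fun _ _ h => t h) ≃ₗ[R] H) := by
  refine ⟨LinearEquiv.ofBijective
    (Module.DirectLimit.lift R ℕ A (fun _ _ h => t h) φ fun _ _ h x => hφ.compat h x) ⟨?_, ?_⟩⟩
  · rw [injective_iff_map_eq_zero]
    intro z hz
    obtain ⟨n, x, rfl⟩ := Module.DirectLimit.exists_of z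
    rw [Module.DirectLimit.lift_of] at hz
    obtain ⟨m, h, hm⟩ := hφ.ker n x hz
    rw [← Module.DirectLimit.of_f (hij := h), hm, map_zero]
  · intro y
    obtain ⟨n, x, rfl⟩ := hφ.surj y
    exact ⟨Module.DirectLimit.of R ℕ A _ n x, Module.DirectLimit.lift_of _ _ _⟩

lemma nonempty_equiv (hφ : IsDirLim t φ) {H' : Type} [AddCommGroup H'] [Module R H']
    {φ' : ∀ n, A n →ₗ[R] H'} (hφ' : IsDirLim t φ') : Nonempty (H ≃ₗ[R] H') := by
  obtain ⟨e⟩ := hφ.nonempty_directLimit_equiv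
  obtain ⟨e'⟩ := hφ'.nonempty_directLimit_equiv
  exact ⟨e.symm ≪≫ₗ e'⟩

/-- A direct limit of `A` is a direct limit of `B` along an essentially bijective map of
directed systems. -/
lemma comp (hφ : IsDirLim t φ) {B : ℕ → Type} [∀ n, AddCommGroup (B n)]
    [∀ n, Module R (B n)] {s : ∀ ⦃n m : ℕ⦄, n ≤ m → B n →ₗ[R] B m}
    (hs : ∀ ⦃n m k : ℕ⦄ (h : n ≤ m) (h' : m ≤ k) x, s h' (s h x) = s (h.trans h') x)
    (f : ∀ n, B n →ₗ[R] A n) (hf : ∀ ⦃n m : ℕ⦄ (h : n ≤ m) x, f m (s h x) = t h (f n x))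
    (hinj : ∀ n x, f n x = 0 → ∃ (m : ℕ) (h : n ≤ m), s h x = 0)
    (hsurj : ∀ n y, ∃ (m : ℕ) (h : n ≤ m) (x : B m), f m x = t h y) :
    IsDirLim s (fun n => φ n ∘ₗ f n) where
  compat n m h x := by simp [hf, hφ.compat]
  surj y := by
    obtain ⟨n, z, rfl⟩ := hφ.surj y
    obtain ⟨m, h, x, hx⟩ := hsurj n z
    exact ⟨m, x, by simp [hx, hφ.compat]⟩
  ker n x hx := by
    obtain ⟨m, h, hm⟩ := hφ.ker n _ hx
    rw [← hf] at hm
    obtain ⟨k, h', hk⟩ := hinj m _ hm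
    exact ⟨k, h.trans h', by rw [← hs h h', hk]⟩

end IsDirLim

section
variable {R : Type} [CommRing R] (a : Ideal R)

abbrev powQuot (n : ℕ) : ModuleCat.{0} R := ModuleCat.of R (R ⧸ a ^ n)

def powQuotMap ⦃n m : ℕ⦄ (h : n ≤ m) : powQuot a m ⟶ powQuot a n :=
  ModuleCat.ofHom (Submodule.mapQ _ _ LinearMap.id (Ideal.pow_le_pow_right h))

lemma powQuotMap_comp ⦃n m k : ℕ⦄ (h : n ≤ m) (h' : m ≤ k) :
    powQuotMap a h' ≫ powQuotMap a h = powQuotMap a (h.trans h') := by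
  ext
  rfl

/-- The transition maps of the direct system `Ext^i(R/a^n, Y)`. -/
def extTrans (Y : ModuleCat.{0} R) (i : ℕ) ⦃n m : ℕ⦄ (h : n ≤ m) :
    Abelian.Ext (powQuot a n) Y i →ₗ[R] Abelian.Ext (powQuot a m) Y i :=
  (Abelian.Ext.mk₀ (powQuotMap a h)).precompOfLinear R Y (zero_add i)

lemma extTrans_apply (Y : ModuleCat.{0} R) (i : ℕ) ⦃n m : ℕ⦄ (h : n ≤ m) (x) :
    extTrans a Y i h x = (Abelian.Ext.mk₀ (powQuotMap a h)).comp x (zero_add i) := rfl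

lemma extTrans_extTrans (Y : ModuleCat.{0} R) (i : ℕ) ⦃n m k : ℕ⦄ (h : n ≤ m) (h' : m ≤ k) (x) :
    extTrans a Y i h' (extTrans a Y i h x) = extTrans a Y i (h.trans h') x := by
  simp only [extTrans_apply]
  rw [← powQuotMap_comp a h h', ← Abelian.Ext.mk₀_comp_mk₀_assoc]

open Opposite Limits in
theorem exists_isDirLim_locCoh (i : ℕ) (M : Type) [AddCommGroup M] [Module R M] :
    ∃ φ : ∀ n, Abelian.Ext (powQuot a n) (ModuleCat.of R M) i →ₗ[R] locCoh R a i M,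
      IsDirLim (extTrans a (ModuleCat.of R M) i) φ := by
  let Y := ModuleCat.of R M
  let F := localCohomology.diagram (localCohomology.idealPowersDiagram a) i
  let c := ((evaluation _ _).obj Y).mapCocone (colimit.cocone F)
  have hc : IsColimit c := isColimitOfPreserves ((evaluation _ _).obj Y) (colimit.isColimit F)
  let P := fun n => projectiveResolution (powQuot a n)
  let e := fun n => DerivedExt.extEquiv (P n) Y i
  have he : ∀ ⦃n m : ℕ⦄ (h : n ≤ m) x, (e m).symm (extTrans a Y i h x) =
      (((Ext R (ModuleCat R) i).map (powQuotMap a h).op).app Y).hom ((e n).symm x) := by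
    intro n m h x
    rw [LinearEquiv.symm_apply_eq]
    refine Eq.trans ?_ (DerivedExt.extEquiv_naturality (P n) Y i (P m) (powQuotMap a h) _).symm
    rw [LinearEquiv.apply_symm_apply]
    rfl
  refine ⟨fun n => (c.ι.app (op (op n))).hom ∘ₗ (e n).symm.toLinearMap, ?_, ?_, ?_⟩
  · intro n m h x
    have := congrArg (fun f => f.hom ((e n).symm x)) (c.w (homOfLE h).op.op)
    refine Eq.trans ?_ this
    exact congrArg (c.ι.app (op (op m))).hom (he h x)
  · intro y
    obtain ⟨j, x, hx⟩ := Concrete.isColimit_exists_rep _ hc y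
    refine ⟨j.unop.unop, e _ x, ?_⟩
    rw [← hx]
    exact congrArg (c.ι.app j).hom ((e _).symm_apply_apply x)
  · intro n x hx
    obtain ⟨k, f, g, h⟩ := (Concrete.isColimit_rep_eq_iff_exists _ hc ((e n).symm x)
      (0 : ((F ⋙ (evaluation _ _).obj Y).obj (op (op n)))) (i := op (op n)) (j := op (op n))).1
      (by rw [map_zero]; exact hx)
    refine ⟨k.unop.unop, leOfHom f.unop.unop, ?_⟩
    rw [map_zero] at h
    rw [← (e _).symm.map_eq_zero_iff, he]
    exact h

end

section Artinian

variable {R : Type} [CommRing R] {L : Type} [AddCommGroup L] [Module R L]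

/-- A module on which `x` acts locally nilpotently is Artinian if the kernel of `x` is. -/
theorem isArtinian_of_isArtinian_torsionBy (x : R) (hx : ∀ y : L, ∃ n : ℕ, x ^ n • y = 0)
    [IsArtinian R (Submodule.torsionBy R L x)] : IsArtinian R L := by
  rw [← monotone_stabilizes_iff_artinian]
  intro f
  let W : ℕ → Submodule R L := fun k => OrderDual.ofDual (f k)
  have hW : ∀ ⦃k l⦄, k ≤ l → W l ≤ W k := fun k l h => f.monotone h
  let K : ℕ → ℕ → Submodule R (Submodule.torsionBy R L x) := fun n k =>
    ((W k).map (LinearMap.lsmul R L (x ^ n))).comap (Submodule.subtype _)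
  have hK : ∀ ⦃n m k l⦄, n ≤ m → k ≤ l → K m l ≤ K n k := by
    rintro n m k l hnm hkl y ⟨z, hz, hzy⟩
    obtain ⟨c, rfl⟩ := Nat.exists_eq_add_of_le hnm
    refine ⟨x ^ c • z, (W k).smul_mem _ (hW hkl hz), ?_⟩
    rw [← hzy]
    simp [pow_add, mul_smul, smul_comm (x ^ c)]
  obtain ⟨d, hd⟩ := IsArtinian.monotone_stabilizes
    (⟨fun k => OrderDual.toDual (K k k), fun k l h => hK h h⟩ :
      ℕ →o (Submodule R (Submodule.torsionBy R L x))ᵒᵈ)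
  have hcol : ∀ n, ∃ k, ∀ l, k ≤ l → K n k = K n l := fun n => IsArtinian.monotone_stabilizes
    (⟨fun k => OrderDual.toDual (K n k), fun k l h => hK le_rfl h⟩ :
      ℕ →o (Submodule R (Submodule.torsionBy R L x))ᵒᵈ)
  choose c hc using hcol
  have hstab : ∃ k, ∀ n l, k ≤ l → K n k ≤ K n l := by
    refine ⟨max d ((Finset.range d).sup c), fun n l hl => ?_⟩
    rcases lt_or_ge n d with hn | hn
    · have h1 : c n ≤ max d ((Finset.range d).sup c) :=
        (Finset.le_sup (f := c) (Finset.mem_range.2 hn)).trans (le_max_right _ _)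
      rw [← hc n _ h1, ← hc n l (h1.trans hl)]
    · have h1 : d ≤ max n l := hn.trans (le_max_left _ _)
      calc K n _ ≤ K d d := hK hn (le_max_left _ _)
        _ = K (max n l) (max n l) := hd _ h1
        _ ≤ K n l := hK (le_max_left _ _) (le_max_right _ _)
  obtain ⟨k, hk⟩ := hstab
  refine ⟨k, fun l hl => le_antisymm ?_ ?_⟩
  · exact f.monotone hl
  change W k ≤ W l
  have key : ∀ n, ∀ y ∈ W k, x ^ n • y = 0 → y ∈ W l := by
    intro n
    induction n with
    | zero => intro y _ h; rw [pow_zero, one_smul] at h; rw [h]; exact zero_mem _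
    | succ n ih =>
      intro y hy h
      have hmem : (⟨x ^ n • y, by
          rw [Submodule.mem_torsionBy_iff, ← mul_smul, ← pow_succ', h]⟩ :
          Submodule.torsionBy R L x) ∈ K n k := ⟨y, hy, rfl⟩
      obtain ⟨z, hz, hzy⟩ := hk n l hl hmem
      have := ih (y - z) ((W k).sub_mem hy (hW hl hz)) (by
        rw [smul_sub, sub_eq_zero]; exact hzy.symm)
      simpa using (W l).add_mem this hz
  intro y hy
  obtain ⟨n, hn⟩ := hx y
  exact key n y hy hn

lemma isArtinian_of_isArtinian_inf_torsionBySet (s : Finset R) (W : Submodule R L)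
    (hs : ∀ x ∈ s, ∀ y ∈ W, ∃ n : ℕ, x ^ n • y = 0)
    (h : IsArtinian R (W ⊓ Submodule.torsionBySet R L s : Submodule R L)) : IsArtinian R W := by
  classical
  induction s using Finset.induction_on generalizing W with
  | empty =>
    have : W ⊓ Submodule.torsionBySet R L ((∅ : Finset R) : Set R) = W := by
      rw [inf_eq_left]
      intro y _
      simp [Submodule.mem_torsionBySet_iff]
    rwa [this] at h
  | insert x s hxs ih =>
    have h1 : IsArtinian R (W ⊓ Submodule.torsionBy R L x : Submodule R L) := by
      refine ih _ (fun x' hx' y hy => hs x' (Finset.mem_insert_of_mem hx') y hy.1) ?_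
      have : W ⊓ Submodule.torsionBy R L x ⊓ Submodule.torsionBySet R L s =
          W ⊓ Submodule.torsionBySet R L (insert x s : Finset R) := by
        ext y
        simp only [Submodule.mem_inf, Submodule.mem_torsionBySet_iff, Submodule.mem_torsionBy_iff,
          Finset.coe_insert, Subtype.forall, Set.mem_insert_iff, forall_eq_or_imp, and_assoc]
      rwa [this]
    have h2 : IsArtinian R (Submodule.torsionBy R W x) := by
      let g : Submodule.torsionBy R W x →ₗ[R] (W ⊓ Submodule.torsionBy R L x : Submodule R L) :=
        LinearMap.codRestrict _ (W.subtype ∘ₗ Submodule.subtype _) (fun y => ⟨y.1.2, by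
          change (y : W).1 ∈ Submodule.torsionBy R L x
          have := y.2
          rw [Submodule.mem_torsionBy_iff] at this
          exact (Submodule.mem_torsionBy_iff _ _).2 <| congrArg Subtype.val this⟩)
      refine isArtinian_of_injective g fun y z h => ?_
      exact Subtype.ext (Subtype.ext (congrArg (fun v => v.1) h))
    refine isArtinian_of_isArtinian_torsionBy x fun y => ?_
    obtain ⟨n, hn⟩ := hs x (Finset.mem_insert_self _ _) y.1 y.2
    exact ⟨n, Subtype.ext hn⟩

/-- Melkersson's criterion for a torsion module to be Artinian. -/
theorem isArtinian_of_isArtinian_torsionBySet {a : Ideal R} (ha : a.FG)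
    (hL : ∀ y : L, ∃ n : ℕ, ∀ r ∈ a ^ n, r • y = 0)
    [h : IsArtinian R (Submodule.torsionBySet R L a)] : IsArtinian R L := by
  obtain ⟨s, rfl⟩ := ha
  suffices IsArtinian R (⊤ : Submodule R L) from
    isArtinian_of_linearEquiv (Submodule.topEquiv (R := R) (M := L))
  refine isArtinian_of_isArtinian_inf_torsionBySet s ⊤ (fun x hx y _ => ?_) ?_
  · obtain ⟨n, hn⟩ := hL y
    exact ⟨n, hn _ (Ideal.pow_mem_pow (Ideal.subset_span hx) n)⟩
  · rw [top_inf_eq, Submodule.torsionBySet_eq_torsionBySet_span]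
    exact h

lemma isMaximal_of_mem_support [IsArtinian R L] {p : PrimeSpectrum R}
    (hp : p ∈ Module.support R L) : p.asIdeal.IsMaximal := by
  obtain ⟨y, hy⟩ := Module.mem_support_iff_exists_annihilator.1 hp
  have hker : LinearMap.ker (LinearMap.toSpanSingleton R L y) ≤ p.asIdeal := by
    intro r hr
    apply hy
    rw [Submodule.mem_annihilator_span_singleton]
    simpa using hr
  have : IsArtinian R (R ⧸ LinearMap.ker (LinearMap.toSpanSingleton R L y)) :=
    isArtinian_of_linearEquiv (LinearMap.quotKerEquivRange _).symm
  have : IsArtinian R (R ⧸ p.asIdeal) := isArtinian_of_surjective _ (Submodule.factor hker)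
    (Submodule.factor_surjective hker)
  have : IsArtinianRing (R ⧸ p.asIdeal) := isArtinian_of_tower R this
  exact Ideal.Quotient.maximal_of_isField _ (IsArtinianRing.isField_of_isDomain _)

lemma krullDim_support_lt_one_iff :
    Order.krullDim (Module.support R L) < (1 : ℕ) ↔
      ∀ p ∈ Module.support R L, p.asIdeal.IsMaximal := by
  have h : Order.krullDim (Module.support R L) < (1 : ℕ) ↔
      Order.krullDim (Module.support R L) ≤ 0 := by
    rw [show ((1 : ℕ) : WithBot ℕ∞) = ((0 : ℕ) : WithBot ℕ∞) + 1 from rfl, ENat.WithBot.lt_add_one_iff]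
    rfl
  rw [h, Order.krullDim_nonpos_iff_forall_isMax]
  refine ⟨fun H p hp => ?_, fun H p q hpq => ?_⟩
  · obtain ⟨m, hm, hpm⟩ := Ideal.exists_le_maximal p.asIdeal p.2.ne_top
    have hle : p ≤ ⟨m, hm.isPrime⟩ := hpm
    have := H ⟨p, hp⟩ (b := ⟨⟨m, hm.isPrime⟩, Module.mem_support_mono hle hp⟩) hle
    have : m ≤ p.asIdeal := this
    rwa [le_antisymm hpm this]
  · exact ((H p p.2).eq_of_le q.1.2.ne_top hpq).ge

lemma isArtinian_of_isMaximal [IsNoetherianRing R] [Module.Finite R L]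
    (h : ∀ p ∈ Module.support R L, p.asIdeal.IsMaximal) : IsArtinian R L := by
  let I := Module.annihilator R L
  have : Ring.KrullDimLE 0 (R ⧸ I) := by
    refine .mk₀ fun q hq => ?_
    have h1 : (q.comap (Ideal.Quotient.mk I)).IsMaximal := by
      refine h ⟨q.comap (Ideal.Quotient.mk I), inferInstance⟩ ?_
      rw [Module.support_eq_zeroLocus, PrimeSpectrum.mem_zeroLocus]
      intro r hr
      change Ideal.Quotient.mk I r ∈ q
      rw [Ideal.Quotient.eq_zero_iff_mem.2 hr]
      exact q.zero_mem
    exact Ideal.map_comap_of_surjective _ Ideal.Quotient.mk_surjective q ▸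
      Ideal.IsMaximal.map_of_surjective_of_ker_le Ideal.Quotient.mk_surjective
        (Ideal.comap_mono bot_le)
  have : IsArtinianRing (R ⧸ I) := IsNoetherianRing.isArtinianRing_of_krullDimLE_zero
  let _ : Module (R ⧸ I) L := (Module.isTorsionBySet_annihilator R L).module
  have : IsScalarTower R (R ⧸ I) L := (Module.isTorsionBySet_annihilator R L).isScalarTower
  have : Module.Finite (R ⧸ I) L := Module.Finite.of_restrictScalars_finite R _ _
  have : IsArtinian (R ⧸ I) L := isArtinian_of_fg_of_artinian'
  exact isArtinian_of_surjective_algebraMap (R := R ⧸ I) Ideal.Quotient.mk_surjective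

lemma IsMinimax.inDimLT_one (h : IsMinimax R L) : InDimLT R L 1 := by
  obtain ⟨N, hN, h⟩ := h
  exact ⟨N, hN, krullDim_support_lt_one_iff.2 fun p hp => isMaximal_of_mem_support hp⟩

variable {L' : Type} [AddCommGroup L'] [Module R L']

lemma InDimLT.of_linearEquiv {n : ℕ} (e : L ≃ₗ[R] L') (h : InDimLT R L n) : InDimLT R L' n := by
  obtain ⟨N, hN, h⟩ := h
  refine ⟨N.map e.toLinearMap, hN.map _, ?_⟩
  rwa [← (Submodule.Quotient.equiv N (N.map e.toLinearMap) e rfl).support_eq]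

lemma IsMinimax.of_linearEquiv (e : L ≃ₗ[R] L') (h : IsMinimax R L) : IsMinimax R L' := by
  obtain ⟨N, hN, h⟩ := h
  exact ⟨N.map e.toLinearMap, hN.map _,
    isArtinian_of_linearEquiv (Submodule.Quotient.equiv N (N.map e.toLinearMap) e rfl)⟩

end Artinian

section ExtMaps

variable {R : Type} [CommRing R]

/-- The map induced on `Ext^i(X, -)` by a morphism. -/
def extMap (X : ModuleCat.{0} R) {Y Y' : ModuleCat.{0} R} (f : Y ⟶ Y') (i : ℕ) :
    Abelian.Ext X Y i →ₗ[R] Abelian.Ext X Y' i :=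
  (Abelian.Ext.mk₀ f).postcompOfLinear R X (add_zero i)

lemma extMap_apply (X : ModuleCat.{0} R) {Y Y' : ModuleCat.{0} R} (f : Y ⟶ Y') (i : ℕ) (x) :
    extMap X f i x = x.comp (Abelian.Ext.mk₀ f) (add_zero i) := rfl

variable {S : ShortComplex (ModuleCat.{0} R)} (hS : S.ShortExact)

/-- The connecting map of the long exact sequence for `Ext(X, -)`. -/
def extδ (X : ModuleCat.{0} R) (i : ℕ) : Abelian.Ext X S.X₃ i →ₗ[R] Abelian.Ext X S.X₁ (i + 1) :=
  hS.extClass.postcompOfLinear R X rfl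

lemma extδ_apply (X : ModuleCat.{0} R) (i : ℕ) (x) : extδ hS X i x = x.comp hS.extClass rfl := rfl

lemma extMap_exact (hS : S.ShortExact) (X : ModuleCat.{0} R) (i : ℕ) :
    Function.Exact (extMap X S.f i) (extMap X S.g i) := by
  intro x
  refine ⟨fun h => Abelian.Ext.covariant_sequence_exact₂ X hS x h, ?_⟩
  rintro ⟨y, rfl⟩
  simp [extMap_apply]

lemma extMap_extδ_exact (X : ModuleCat.{0} R) (i : ℕ) :
    Function.Exact (extMap X S.g i) (extδ hS X i) := by
  intro x
  refine ⟨fun h => Abelian.Ext.covariant_sequence_exact₃ X hS x rfl h, ?_⟩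
  rintro ⟨y, rfl⟩
  rw [extMap_apply, extδ_apply, Abelian.Ext.comp_assoc_of_second_deg_zero]
  simp

lemma extδ_extMap_exact (X : ModuleCat.{0} R) (i : ℕ) :
    Function.Exact (extδ hS X i) (extMap X S.f (i + 1)) := by
  intro x
  refine ⟨fun h => Abelian.Ext.covariant_sequence_exact₁ X hS x h rfl, ?_⟩
  rintro ⟨y, rfl⟩
  rw [extMap_apply, extδ_apply, Abelian.Ext.comp_assoc_of_third_deg_zero]
  simp

lemma extMap_zero_injective (hS : S.ShortExact) (X : ModuleCat.{0} R) : Function.Injective (extMap X S.f 0) :=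
  have := hS.mono_f
  Abelian.Ext.postcomp_mk₀_injective_of_mono X S.f

variable (a : Ideal R)

lemma extMap_extTrans {Y Y' : ModuleCat.{0} R} (f : Y ⟶ Y') (i : ℕ) ⦃n m : ℕ⦄ (h : n ≤ m) (x) :
    extMap _ f i (extTrans a Y i h x) = extTrans a Y' i h (extMap _ f i x) := by
  simp [extMap_apply, extTrans_apply]

lemma extδ_extTrans (i : ℕ) ⦃n m : ℕ⦄ (h : n ≤ m) (x) :
    extδ hS _ i (extTrans a S.X₃ i h x) = extTrans a S.X₁ (i + 1) h (extδ hS _ i x) := by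
  simp only [extδ_apply, extTrans_apply]
  exact Abelian.Ext.comp_assoc _ _ _ _ _ (by lia)

/-- All the modules `Ext^s(X, Y)` are finitely generated. -/
def ExtFinite (X Y : ModuleCat.{0} R) : Prop := ∀ s, Module.Finite R (Abelian.Ext X Y s)

lemma finite_of_exact [IsNoetherianRing R] {A B C : Type} [AddCommGroup A] [AddCommGroup B] [AddCommGroup C]
    [Module R A] [Module R B] [Module R C] {f : A →ₗ[R] B} {g : B →ₗ[R] C}
    (h : Function.Exact f g) [Module.Finite R A] [Module.Finite R C] : Module.Finite R B := by
  have := isNoetherian_of_range_eq_ker f g h.linearMap_ker_eq.symm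
  infer_instance

variable [IsNoetherianRing R] {X : ModuleCat.{0} R}

lemma ExtFinite.of_shortExact₂ (hS : S.ShortExact) (h₁ : ExtFinite X S.X₁) (h₃ : ExtFinite X S.X₃) :
    ExtFinite X S.X₂ := fun s =>
  have := h₁ s
  have := h₃ s
  finite_of_exact (extMap_exact hS X s)

lemma ExtFinite.of_shortExact₃ (hS : S.ShortExact) (h₁ : ExtFinite X S.X₁) (h₂ : ExtFinite X S.X₂) :
    ExtFinite X S.X₃ := fun s =>
  have := h₁ (s + 1)
  have := h₂ s
  finite_of_exact (extMap_extδ_exact hS X s)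

lemma ExtFinite.of_finite (X Y : ModuleCat.{0} R) [Module.Finite R X] [Module.Finite R Y] :
    ExtFinite X Y := fun _ => inferInstance

end ExtMaps

section Good

variable {R : Type} [CommRing R] (a : Ideal R)

/-- Evaluation at `1`, on `Ext^0(R/a^n, Y) = Hom(R/a^n, Y)`. -/
def evalOne (n : ℕ) (Y : ModuleCat.{0} R) : Abelian.Ext (powQuot a n) Y 0 →ₗ[R] Y :=
  LinearMap.applyₗ (Submodule.Quotient.mk 1) ∘ₗ
    (ModuleCat.homLinearEquiv (S := R)).toLinearMap ∘ₗ
    (Abelian.Ext.linearEquiv₀ (R := R)).toLinearMap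

lemma evalOne_mk₀ (n : ℕ) (Y : ModuleCat.{0} R) (f : powQuot a n ⟶ Y) :
    evalOne a n Y (Abelian.Ext.mk₀ f) = f.hom (Submodule.Quotient.mk 1) := by
  have : Abelian.Ext.linearEquiv₀ (R := R) (Abelian.Ext.mk₀ f) = f :=
    Abelian.Ext.linearEquiv₀.apply_symm_apply f
  simp only [evalOne, LinearMap.comp_apply, LinearEquiv.coe_coe, this]
  rfl

lemma exists_mk₀ {X Y : ModuleCat.{0} R} (x : Abelian.Ext X Y 0) :
    ∃ f : X ⟶ Y, x = Abelian.Ext.mk₀ f :=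
  ⟨_, (Abelian.Ext.linearEquiv₀ (R := R).symm_apply_apply x).symm⟩

lemma evalOne_injective (n : ℕ) (Y : ModuleCat.{0} R) : Function.Injective (evalOne a n Y) := by
  rw [injective_iff_map_eq_zero]
  intro x hx
  obtain ⟨f, rfl⟩ := exists_mk₀ x
  rw [evalOne_mk₀] at hx
  have : f = 0 := by
    refine ModuleCat.hom_ext (LinearMap.ext fun y => ?_)
    obtain ⟨r, rfl⟩ := Submodule.Quotient.mk_surjective _ y
    have : (Submodule.Quotient.mk r : R ⧸ a ^ n) = r • Submodule.Quotient.mk 1 := by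
      rw [← Submodule.Quotient.mk_smul, smul_eq_mul, mul_one]
    rw [this, map_smul, hx, smul_zero]
    rfl
  rw [this, Abelian.Ext.mk₀_zero]

lemma exists_evalOne_eq (n : ℕ) (Y : ModuleCat.{0} R) (y : Y) (hy : ∀ r ∈ a ^ n, r • y = 0) :
    ∃ x, evalOne a n Y x = y := by
  refine ⟨Abelian.Ext.mk₀ (ModuleCat.ofHom
    (Submodule.liftQ _ (LinearMap.toSpanSingleton R Y y) ?_)), ?_⟩
  · intro r hr
    exact hy r hr
  · rw [evalOne_mk₀]
    exact one_smul R y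

lemma smul_evalOne (n : ℕ) (Y : ModuleCat.{0} R) (x) (r : R) (hr : r ∈ a ^ n) :
    r • evalOne a n Y x = 0 := by
  obtain ⟨f, rfl⟩ := exists_mk₀ x
  rw [evalOne_mk₀, ← map_smul, ← Submodule.Quotient.mk_smul, smul_eq_mul, mul_one,
    (Submodule.Quotient.mk_eq_zero _).2 hr, map_zero]

lemma evalOne_extTrans (Y : ModuleCat.{0} R) ⦃n m : ℕ⦄ (h : n ≤ m) (x) :
    evalOne a m Y (extTrans a Y 0 h x) = evalOne a n Y x := by
  obtain ⟨f, rfl⟩ := exists_mk₀ x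
  rw [extTrans_apply, Abelian.Ext.mk₀_comp_mk₀, evalOne_mk₀, evalOne_mk₀]
  rfl

lemma evalOne_extMap (n : ℕ) {Y Y' : ModuleCat.{0} R} (f : Y ⟶ Y') (x) :
    evalOne a n Y' (extMap _ f 0 x) = f.hom (evalOne a n Y x) := by
  obtain ⟨g, rfl⟩ := exists_mk₀ x
  rw [extMap_apply, Abelian.Ext.mk₀_comp_mk₀, evalOne_mk₀, evalOne_mk₀]
  rfl

lemma finite_torsionBySet [IsNoetherianRing R] (Y : ModuleCat.{0} R)
    [Module.Finite R (Abelian.Ext (powQuot a 1) Y 0)] :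
    Module.Finite R (Submodule.torsionBySet R Y a) := by
  have : Module.Finite R (LinearMap.range (evalOne a 1 Y)) := inferInstance
  refine Module.Finite.of_injective (Submodule.inclusion (?_ : _ ≤ LinearMap.range (evalOne a 1 Y)))
    (Submodule.inclusion_injective _)
  intro y hy
  refine exists_evalOne_eq a 1 Y y fun r hr => ?_
  rw [pow_one] at hr
  exact (Submodule.mem_torsionBySet_iff _ _).1 hy ⟨r, hr⟩

lemma extMap_smul_eq_zero (Y : ModuleCat.{0} R) (s : ℕ) {r : R} (hr : r ∈ a)
    (x : Abelian.Ext (powQuot a 1) Y s) :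
    extMap _ (ModuleCat.ofHom (LinearMap.lsmul R Y r)) s x = 0 := by
  have h1 : (ModuleCat.ofHom (LinearMap.lsmul R Y r) : Y ⟶ Y) = r • 𝟙 Y := rfl
  have h2 : r • 𝟙 (powQuot a 1) = 0 := by
    refine ModuleCat.hom_ext (LinearMap.ext fun y => ?_)
    obtain ⟨t, rfl⟩ := Submodule.Quotient.mk_surjective _ y
    change (Submodule.Quotient.mk (r • t) : R ⧸ a ^ 1) = 0
    rw [Submodule.Quotient.mk_eq_zero, pow_one]
    exact a.mul_mem_right _ hr
  have h3 : r • x = 0 := by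
    have := Abelian.Ext.smul_comp (R := R) (Abelian.Ext.mk₀ (𝟙 (powQuot a 1))) x (zero_add s)
    rw [Abelian.Ext.mk₀_id_comp] at this
    rw [← this, ← Abelian.Ext.mk₀_smul, h2]
    simp
  rw [extMap_apply, h1, Abelian.Ext.mk₀_smul, Abelian.Ext.comp_smul, Abelian.Ext.comp_mk₀_id, h3]

lemma ExtFinite.of_iso {X Y Y' : ModuleCat.{0} R} (e : Y ≅ Y') (h : ExtFinite X Y) :
    ExtFinite X Y' := fun s =>
  have := h s
  Module.Finite.of_surjective (extMap X e.hom s) fun x =>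
    ⟨extMap X e.inv s x, by simp [extMap_apply]⟩

variable {L : Type} [AddCommGroup L] [Module R L]

lemma extFinite_of_isArtinian [IsNoetherianRing R] [IsArtinian R L]
    [Module.Finite R (Submodule.torsionBySet R L a)] (W : Submodule R L) :
    ExtFinite (powQuot a 1) (ModuleCat.of R W) := by
  induction W using WellFoundedLT.induction with
  | ind W ih =>
  have ih' : ∀ K : Submodule R W, K ≠ ⊤ → ExtFinite (powQuot a 1) (ModuleCat.of R K) := by
    intro K hK
    have hlt : K.map W.subtype < W := by
      refine lt_of_le_of_ne (Submodule.map_subtype_le _ _) fun h => hK ?_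
      refine Submodule.map_injective_of_injective W.subtype_injective ?_
      rw [h, Submodule.map_subtype_top]
    exact (ih _ hlt).of_iso
      (Submodule.equivMapOfInjective W.subtype W.subtype_injective K).symm.toModuleIso
  by_cases h : ∃ r ∈ a, LinearMap.lsmul R W r ≠ 0
  · obtain ⟨r, hr, hr0⟩ := h
    have hker : ExtFinite (powQuot a 1) (ModuleCat.of R (LinearMap.ker (LinearMap.lsmul R W r))) :=
      ih' _ fun h => hr0 (LinearMap.ker_eq_top.1 h)
    by_cases hrange : LinearMap.range (LinearMap.lsmul R W r) = ⊤
    · have hS := LinearMap.shortExact_shortComplexKer (LinearMap.range_eq_top.1 hrange)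
      intro s
      have := hker s
      refine Module.Finite.of_surjective (extMap _ _ s) fun x => (extMap_exact hS _ s x).1 ?_
      exact extMap_smul_eq_zero a _ s hr x
    · have hS := LinearMap.shortExact_shortComplexKer
        (LinearMap.surjective_rangeRestrict (LinearMap.lsmul R W r))
      refine ExtFinite.of_shortExact₂ hS (ih' _ ?_) (ih' _ hrange)
      rw [LinearMap.ker_rangeRestrict]
      exact fun h => hr0 (LinearMap.ker_eq_top.1 h)
  · push Not at h
    have hle : W ≤ Submodule.torsionBySet R L a := by
      intro y hy
      refine (Submodule.mem_torsionBySet_iff _ _).2 fun r => ?_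
      exact congrArg Subtype.val (LinearMap.congr_fun (h r r.2) ⟨y, hy⟩)
    have : Module.Finite R W := Module.Finite.of_injective (Submodule.inclusion hle)
      (Submodule.inclusion_injective _)
    exact ExtFinite.of_finite _ _

/-- The short exact sequence of a submodule and its quotient. -/
def subQuot (N : Submodule R L) : ShortComplex (ModuleCat.{0} R) where
  X₁ := ModuleCat.of R N
  X₂ := ModuleCat.of R L
  X₃ := ModuleCat.of R (L ⧸ N)
  f := ModuleCat.ofHom N.subtype
  g := ModuleCat.ofHom N.mkQ
  zero := by ext x; simp

lemma subQuot_shortExact (N : Submodule R L) : (subQuot N).ShortExact where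
  exact := (ShortComplex.ShortExact.moduleCat_exact_iff_function_exact _).2 <|
    LinearMap.exact_subtype_mkQ N
  mono_f := (ModuleCat.mono_iff_injective _).2 N.subtype_injective
  epi_g := (ModuleCat.epi_iff_surjective _).2 N.mkQ_surjective

theorem isMinimax_and_extFinite_of_torsion [IsNoetherianRing R]
    (hL : ∀ y : L, ∃ n : ℕ, ∀ r ∈ a ^ n, r • y = 0) (h : InDimLT R L 1)
    [Module.Finite R (Abelian.Ext (powQuot a 1) (ModuleCat.of R L) 0)] :
    IsMinimax R L ∧ ExtFinite (powQuot a 1) (ModuleCat.of R L) := by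
  obtain ⟨N, hN, h⟩ := h
  have : Module.Finite R N := Module.Finite.iff_fg.2 hN
  have hS := subQuot_shortExact N
  have hNE : ExtFinite (powQuot a 1) (ModuleCat.of R N) := ExtFinite.of_finite _ _
  have : Module.Finite R (Abelian.Ext (powQuot a 1) (ModuleCat.of R (L ⧸ N)) 0) :=
    have : Module.Finite R (Abelian.Ext (powQuot a 1) (subQuot N).X₁ (0 + 1)) := hNE 1
    have : Module.Finite R (Abelian.Ext (powQuot a 1) (subQuot N).X₂ 0) := inferInstanceAs
      (Module.Finite R (Abelian.Ext (powQuot a 1) (ModuleCat.of R L) 0))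
    finite_of_exact (extMap_extδ_exact hS (powQuot a 1) 0)
  have : Module.Finite R (Submodule.torsionBySet R (L ⧸ N) a) :=
    finite_torsionBySet a (ModuleCat.of R (L ⧸ N))
  have : IsArtinian R (Submodule.torsionBySet R (L ⧸ N) a) := by
    refine isArtinian_of_isMaximal fun p hp => krullDim_support_lt_one_iff.1 h p ?_
    exact Module.support_subset_of_injective _ (Submodule.subtype_injective _) hp
  have : IsArtinian R (L ⧸ N) := by
    refine isArtinian_of_isArtinian_torsionBySet (IsNoetherian.noetherian a) fun y => ?_
    obtain ⟨y, rfl⟩ := N.mkQ_surjective y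
    obtain ⟨n, hn⟩ := hL y
    exact ⟨n, fun r hr => by rw [← map_smul, hn r hr, map_zero]⟩
  refine ⟨⟨N, hN, this⟩, ExtFinite.of_shortExact₂ hS hNE ?_⟩
  exact (extFinite_of_isArtinian a (⊤ : Submodule R (L ⧸ N))).of_iso
    (Submodule.topEquiv (R := R) (M := L ⧸ N)).toModuleIso

end Good

section PowTorsion

variable {R : Type} [CommRing R] (a : Ideal R) (L : Type) [AddCommGroup L] [Module R L]

/-- The submodule of elements annihilated by some power of `a`. -/
def powTorsion : Submodule R L where
  carrier := {y | ∃ n : ℕ, ∀ r ∈ a ^ n, r • y = 0}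
  zero_mem' := ⟨0, fun _ _ => smul_zero _⟩
  add_mem' := by
    rintro y z ⟨n, hn⟩ ⟨m, hm⟩
    refine ⟨max n m, fun r hr => ?_⟩
    rw [smul_add, hn r (Ideal.pow_le_pow_right (le_max_left _ _) hr),
      hm r (Ideal.pow_le_pow_right (le_max_right _ _) hr), add_zero]
  smul_mem' := by
    rintro c y ⟨n, hn⟩
    exact ⟨n, fun r hr => by rw [smul_comm, hn r hr, smul_zero]⟩

variable {a L}

lemma exists_pow_smul_eq_zero_of_powTorsion (y : powTorsion a L) : ∃ n : ℕ, ∀ r ∈ a ^ n, r • y = 0 := by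
  obtain ⟨n, hn⟩ := y.2
  exact ⟨n, fun r hr => Subtype.ext (hn r hr)⟩

lemma exists_pow_smul_eq_zero {N : Submodule R L} (hN : N.FG) (h : N ≤ powTorsion a L) :
    ∃ n : ℕ, ∀ r ∈ a ^ n, ∀ y ∈ N, r • y = 0 := by
  obtain ⟨s, rfl⟩ := hN
  have h' : ∀ y : s, ∃ n : ℕ, ∀ r ∈ a ^ n, r • (y : L) = 0 := fun y => h (Submodule.subset_span y.2)
  choose c hc using h'
  refine ⟨Finset.univ.sup c, fun r hr => ?_⟩
  change Submodule.span R (s : Set L) ≤ LinearMap.ker (LinearMap.lsmul R L r)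
  rw [Submodule.span_le]
  intro y hy
  exact hc ⟨y, hy⟩ r (Ideal.pow_le_pow_right (Finset.le_sup (f := c) (Finset.mem_univ _)) hr)

variable [IsNoetherianRing R]

lemma powTorsion_quotient_eq_bot : powTorsion a (L ⧸ powTorsion a L) = ⊥ := by
  rw [eq_bot_iff]
  rintro y ⟨n, hn⟩
  obtain ⟨y, rfl⟩ := Submodule.mkQ_surjective _ y
  have hfg : (Submodule.map (LinearMap.toSpanSingleton R L y) (a ^ n)).FG :=
    Submodule.FG.map _ (IsNoetherian.noetherian (a ^ n))
  obtain ⟨m, hm⟩ := exists_pow_smul_eq_zero (a := a) hfg (by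
    rintro _ ⟨r, hr, rfl⟩
    have := hn r hr
    rwa [← map_smul, Submodule.mkQ_apply, Submodule.Quotient.mk_eq_zero] at this)
  rw [Submodule.mem_bot, Submodule.mkQ_apply, Submodule.Quotient.mk_eq_zero]
  refine ⟨m + n, fun r hr => ?_⟩
  rw [pow_add] at hr
  induction hr using Submodule.mul_induction_on' with
  | mem_mul_mem r hr s hs =>
    rw [mul_smul]
    exact hm r hr _ ⟨s, hs, rfl⟩
  | add r _ s _ h1 h2 => rw [add_smul, h1, h2, add_zero]

lemma injective_powTorsion [Module.Injective R L] : Module.Injective R (powTorsion a L) := by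
  refine Module.Baer.injective fun I f => ?_
  obtain ⟨n, hn⟩ := exists_pow_smul_eq_zero (a := a) (N := LinearMap.range f)
    ((LinearMap.range_eq_map f) ▸ (Module.Finite.fg_top (R := R) (M := I)).map _)
    (fun y _ => exists_pow_smul_eq_zero_of_powTorsion y)
  obtain ⟨k, hk⟩ := Ideal.exists_pow_inf_eq_pow_smul a (M := R) I
  have hkill : ∀ (r : R) (hr : r ∈ I), r ∈ a ^ (n + k) → f ⟨r, hr⟩ = 0 := by
    intro r hr hr'
    have h1 : r ∈ a ^ (n + k) • (⊤ : Submodule R R) ⊓ I := ⟨by simpa using hr', hr⟩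
    rw [hk _ (Nat.le_add_left _ _), Nat.add_sub_cancel] at h1
    have h2 : a ^ n • (a ^ k • (⊤ : Submodule R R) ⊓ I) ≤
        (LinearMap.ker f).map (Submodule.subtype I) := by
      rw [Submodule.smul_le]
      intro s hs t ht
      refine ⟨s • ⟨t, ht.2⟩, ?_, rfl⟩
      rw [SetLike.mem_coe, LinearMap.mem_ker, map_smul]
      exact hn s hs _ ⟨_, rfl⟩
    obtain ⟨t, ht, htr⟩ := h2 h1
    have : t = ⟨r, hr⟩ := Subtype.ext htr
    rw [← this]
    exact ht
  let g : I →ₗ[R] R ⧸ a ^ (n + k) := Submodule.mkQ _ ∘ₗ I.subtype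
  have hg : LinearMap.ker g ≤ LinearMap.ker f := by
    intro r hr
    refine hkill r r.2 ?_
    exact (Submodule.Quotient.mk_eq_zero _).1 hr
  let h : LinearMap.range g →ₗ[R] L := (powTorsion a L).subtype ∘ₗ
    (LinearMap.ker g).liftQ f hg ∘ₗ g.quotKerEquivRange.symm.toLinearMap
  obtain ⟨F, hF⟩ := Module.Injective.out (LinearMap.range g).subtype
    (Submodule.subtype_injective _) h
  have hF' : ∀ r : I, F (g r) = f r := by
    intro r
    refine (hF ⟨g r, r, rfl⟩).trans ?_
    have : g.quotKerEquivRange.symm ⟨g r, r, rfl⟩ = Submodule.Quotient.mk r := by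
      rw [LinearEquiv.symm_apply_eq]
      rfl
    simp [h, this]
  have h1 : F (Submodule.Quotient.mk 1) ∈ powTorsion a L := by
    refine ⟨n + k, fun r hr => ?_⟩
    rw [← map_smul, ← Submodule.Quotient.mk_smul, smul_eq_mul, mul_one,
      (Submodule.Quotient.mk_eq_zero _).2 hr, map_zero]
  refine ⟨LinearMap.toSpanSingleton R _ ⟨_, h1⟩, fun r hr => Subtype.ext ?_⟩
  rw [← hF' ⟨r, hr⟩, LinearMap.toSpanSingleton_apply, Submodule.coe_smul, ← map_smul,
    ← Submodule.Quotient.mk_smul, smul_eq_mul, mul_one]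
  rfl

end PowTorsion

section DimensionShift

variable {R : Type} [CommRing R] (a : Ideal R)

/-- A short complex attached to an exact sequence of modules. -/
def modComplex {A B C : Type} [AddCommGroup A] [AddCommGroup B] [AddCommGroup C] [Module R A]
    [Module R B] [Module R C] (f : A →ₗ[R] B) (g : B →ₗ[R] C) (h : Function.Exact f g) :
    ShortComplex (ModuleCat.{0} R) where
  X₁ := ModuleCat.of R A
  X₂ := ModuleCat.of R B
  X₃ := ModuleCat.of R C
  f := ModuleCat.ofHom f
  g := ModuleCat.ofHom g
  zero := ModuleCat.hom_ext (LinearMap.ext fun x => (h _).2 ⟨x, rfl⟩)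

lemma modComplex_shortExact {A B C : Type} [AddCommGroup A] [AddCommGroup B] [AddCommGroup C]
    [Module R A] [Module R B] [Module R C] {f : A →ₗ[R] B} {g : B →ₗ[R] C}
    (h : Function.Exact f g) (hf : Function.Injective f) (hg : Function.Surjective g) :
    (modComplex f g h).ShortExact where
  exact := (ShortComplex.ShortExact.moduleCat_exact_iff_function_exact _).2 h
  mono_f := (ModuleCat.mono_iff_injective _).2 hf
  epi_g := (ModuleCat.epi_iff_surjective _).2 hg

lemma isDirLim_powTorsion (M : Type) [AddCommGroup M] [Module R M] :
    IsDirLim (extTrans a (ModuleCat.of R M) 0) (fun n =>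
      LinearMap.codRestrict (powTorsion a M) (evalOne a n (ModuleCat.of R M))
        fun x => ⟨n, smul_evalOne a n _ x⟩) where
  compat _ _ h x := Subtype.ext (evalOne_extTrans a _ h x)
  surj := by
    rintro ⟨y, n, hn⟩
    obtain ⟨x, hx⟩ := exists_evalOne_eq a n (ModuleCat.of R M) y hn
    exact ⟨n, x, Subtype.ext hx⟩
  ker n x hx := by
    have : x = 0 := evalOne_injective a n (ModuleCat.of R M) (by
      rw [map_zero]
      exact congrArg Subtype.val hx)
    exact ⟨n, le_rfl, by rw [this, map_zero]⟩

lemma exists_injective_hull (M : Type) [AddCommGroup M] [Module R M] :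
    ∃ (J : Type) (_ : AddCommGroup J) (_ : Module R J) (_ : Module.Injective R J)
      (f : M →ₗ[R] J), Function.Injective f := by
  let Y := ModuleCat.of R M
  refine ⟨(Injective.under Y : ModuleCat R), inferInstance, inferInstance, ?_,
    (Injective.ι Y).hom, ?_⟩
  · have : Injective (ModuleCat.of R (Injective.under Y : ModuleCat R)) :=
      inferInstanceAs (Injective (Injective.under Y))
    exact Module.injective_module_of_injective_object R _
  · exact (ModuleCat.mono_iff_injective _).1 inferInstance

lemma ext_eq_zero_of_injective (X : ModuleCat.{0} R) (J : Type) [AddCommGroup J] [Module R J]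
    [Module.Injective R J] (s : ℕ) (x : Abelian.Ext X (ModuleCat.of R J) (s + 1)) : x = 0 :=
  have : Injective (ModuleCat.of R J) := Module.injective_object_of_injective_module R J
  Abelian.Ext.eq_zero_of_injective x

variable [IsNoetherianRing R]

lemma exists_extTrans_eq_zero_of_torsion (j n : ℕ) (T : Type) [AddCommGroup T] [Module R T]
    (hT : ∀ y : T, ∃ n : ℕ, ∀ r ∈ a ^ n, r • y = 0)
    (x : Abelian.Ext (powQuot a n) (ModuleCat.of R T) (j + 1)) :
    ∃ (m : ℕ) (h : n ≤ m), extTrans a _ _ h x = 0 := by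
  induction j using Nat.strong_induction_on generalizing T with
  | h j ih =>
  obtain ⟨J, _, _, _, f₀, hf₀⟩ := exists_injective_hull (R := R) T
  have hI := injective_powTorsion (a := a) (L := J)
  let f : T →ₗ[R] powTorsion a J := f₀.codRestrict _ fun y => by
    obtain ⟨n, hn⟩ := hT y
    exact ⟨n, fun r hr => by rw [← map_smul, hn r hr, map_zero]⟩
  have hf : Function.Injective f := fun y z h => hf₀ (congrArg Subtype.val h)
  have hS := modComplex_shortExact (LinearMap.exact_map_mkQ_range f) hf
    (Submodule.mkQ_surjective _)
  obtain ⟨y, rfl⟩ := (extδ_extMap_exact hS (powQuot a n) j x).1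
    (ext_eq_zero_of_injective (powQuot a n) (powTorsion a J) j _)
  suffices ∃ (m : ℕ) (h : n ≤ m), extδ hS _ j (extTrans a _ _ h y) = 0 by
    obtain ⟨m, h, hm⟩ := this
    exact ⟨m, h, (extδ_extTrans hS a j h y).symm.trans hm⟩
  cases j with
  | zero =>
    obtain ⟨z, hz⟩ := Submodule.mkQ_surjective _
      (evalOne a n (ModuleCat.of R (powTorsion a J ⧸ LinearMap.range f)) y)
    obtain ⟨m, hm⟩ := exists_pow_smul_eq_zero_of_powTorsion z
    obtain ⟨w, hw⟩ := exists_evalOne_eq a (max n m) (ModuleCat.of R (powTorsion a J)) z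
      fun r hr => hm r (Ideal.pow_le_pow_right (le_max_right _ _) hr)
    refine ⟨max n m, le_max_left _ _, (extMap_extδ_exact hS (powQuot a _) 0 _).2 ⟨w, ?_⟩⟩
    refine evalOne_injective a _ _ ?_
    refine (evalOne_extMap a _
      (modComplex f _ (LinearMap.exact_map_mkQ_range f)).g w).trans ?_
    refine Eq.trans ?_ (evalOne_extTrans a _ _ y).symm
    exact (congrArg (LinearMap.range f).mkQ hw).trans hz
  | succ j =>
    obtain ⟨m, h, hm⟩ := ih j (Nat.lt_succ_self j) (powTorsion a J ⧸ LinearMap.range f) (fun c => by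
      obtain ⟨z, rfl⟩ := Submodule.mkQ_surjective _ c
      obtain ⟨m, hm⟩ := exists_pow_smul_eq_zero_of_powTorsion z
      exact ⟨m, fun r hr => by rw [← map_smul, hm r hr, map_zero]⟩) y
    exact ⟨m, h, (congrArg _ hm).trans (map_zero _)⟩

/-- A module without `a`-torsion embeds in a module `E` with `Ext^s(R/a^n, E) = 0` for all
`s` and `n`. -/
lemma exists_embedding_acyclic (M : Type) [AddCommGroup M] [Module R M]
    (hM : powTorsion a M = ⊥) :
    ∃ (E : Type) (_ : AddCommGroup E) (_ : Module R E) (f : M →ₗ[R] E), Function.Injective f ∧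
      ∀ (n s : ℕ) (x : Abelian.Ext (powQuot a n) (ModuleCat.of R E) s), x = 0 := by
  obtain ⟨J, _, _, _, f, hf⟩ := exists_injective_hull (R := R) M
  refine ⟨J ⧸ powTorsion a J, inferInstance, inferInstance, (powTorsion a J).mkQ ∘ₗ f, ?_, ?_⟩
  · rw [← LinearMap.ker_eq_bot, eq_bot_iff, ← hM]
    intro y hy
    obtain ⟨n, hn⟩ := (Submodule.Quotient.mk_eq_zero _).1 hy
    refine ⟨n, fun r hr => hf ?_⟩
    rw [map_smul, hn r hr, map_zero]
  · intro n s x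
    cases s with
    | zero =>
      refine evalOne_injective a n _ ?_
      rw [map_zero]
      have h : evalOne a n _ x ∈ powTorsion a (J ⧸ powTorsion a J) := ⟨n, smul_evalOne a n _ x⟩
      rwa [powTorsion_quotient_eq_bot] at h
    | succ s =>
      have hS := subQuot_shortExact (powTorsion a J)
      have := injective_powTorsion (a := a) (L := J)
      obtain ⟨y, rfl⟩ := (extMap_extδ_exact hS (powQuot a n) (s + 1) x).1
        (ext_eq_zero_of_injective (powQuot a n) (powTorsion a J) (s + 1) _)
      have hy : y = 0 := ext_eq_zero_of_injective (powQuot a n) J s y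
      exact (congrArg _ hy).trans (map_zero _)

/-- The dimension shift for local cohomology. -/
lemma exists_locCoh_shift (M : Type) [AddCommGroup M] [Module R M] (hM : powTorsion a M = ⊥)
    (hfin : ExtFinite (powQuot a 1) (ModuleCat.of R M)) :
    ∃ (C : Type) (_ : AddCommGroup C) (_ : Module R C),
      ExtFinite (powQuot a 1) (ModuleCat.of R C) ∧
      ∀ j, Nonempty (locCoh R a j C ≃ₗ[R] locCoh R a (j + 1) M) := by
  obtain ⟨E, _, _, f, hf, hE⟩ := exists_embedding_acyclic a M hM
  have hS := modComplex_shortExact (LinearMap.exact_map_mkQ_range f) hf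
    (Submodule.mkQ_surjective _)
  refine ⟨E ⧸ LinearMap.range f, inferInstance, inferInstance, ?_, fun j => ?_⟩
  · refine ExtFinite.of_shortExact₃ hS hfin fun s => ?_
    have : Subsingleton (Abelian.Ext (powQuot a 1) (ModuleCat.of R E) s) :=
      subsingleton_of_forall_eq 0 (hE 1 s)
    exact Module.Finite.of_finite (M := Abelian.Ext (powQuot a 1) (ModuleCat.of R E) s)
  · obtain ⟨φ, hφ⟩ := exists_isDirLim_locCoh a j (E ⧸ LinearMap.range f)
    obtain ⟨ψ, hψ⟩ := exists_isDirLim_locCoh a (j + 1) M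
    refine hφ.nonempty_equiv (hψ.comp (extTrans_extTrans a _ j)
      (fun n => extδ hS (powQuot a n) j) (fun _ _ h x => extδ_extTrans hS a j h x) ?_ ?_)
    · intro n x hx
      obtain ⟨y, rfl⟩ := (extMap_extδ_exact hS (powQuot a n) j x).1 hx
      have : y = 0 := hE n j y
      exact ⟨n, le_rfl, by rw [this, map_zero, map_zero]⟩
    · intro n y
      obtain ⟨x, hx⟩ := (extδ_extMap_exact hS (powQuot a n) j (extTrans a _ _ le_rfl y)).1
        (hE n (j + 1) _)
      exact ⟨n, le_rfl, x, hx⟩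

lemma nonempty_locCoh_succ_equiv (M : Type) [AddCommGroup M] [Module R M] (j : ℕ) :
    Nonempty (locCoh R a (j + 1) M ≃ₗ[R] locCoh R a (j + 1) (M ⧸ powTorsion a M)) := by
  have hS := subQuot_shortExact (powTorsion a M)
  obtain ⟨φ, hφ⟩ := exists_isDirLim_locCoh a (j + 1) M
  obtain ⟨ψ, hψ⟩ := exists_isDirLim_locCoh a (j + 1) (M ⧸ powTorsion a M)
  refine hφ.nonempty_equiv (hψ.comp (extTrans_extTrans a _ _)
    (fun n => extMap (powQuot a n) (subQuot (powTorsion a M)).g (j + 1))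
    (fun _ _ h x => extMap_extTrans a _ _ h x) ?_ ?_)
  · intro n x hx
    obtain ⟨t, rfl⟩ := (extMap_exact hS (powQuot a n) (j + 1) x).1 hx
    obtain ⟨m, h, hm⟩ := exists_extTrans_eq_zero_of_torsion a j n (powTorsion a M)
      exists_pow_smul_eq_zero_of_powTorsion t
    exact ⟨m, h, by
      rw [← extMap_extTrans]
      exact (congrArg _ hm).trans (map_zero _)⟩
  · intro n y
    obtain ⟨m, h, hm⟩ := exists_extTrans_eq_zero_of_torsion a (j + 1) n (powTorsion a M)
      exists_pow_smul_eq_zero_of_powTorsion (extδ hS (powQuot a n) (j + 1) y)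
    obtain ⟨x, hx⟩ := (extMap_extδ_exact hS (powQuot a m) (j + 1) (extTrans a _ _ h y)).1
      ((extδ_extTrans hS a (j + 1) h y).trans hm)
    exact ⟨m, h, x, hx⟩

lemma isMinimax_and_extFinite_powTorsion (M : Type) [AddCommGroup M] [Module R M]
    (hM : ExtFinite (powQuot a 1) (ModuleCat.of R M)) (h : InDimLT R (locCoh R a 0 M) 1) :
    IsMinimax R (powTorsion a M) ∧
      ExtFinite (powQuot a 1) (ModuleCat.of R (powTorsion a M)) := by
  obtain ⟨φ, hφ⟩ := exists_isDirLim_locCoh a 0 M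
  obtain ⟨e⟩ := hφ.nonempty_equiv (isDirLim_powTorsion a M)
  have : Module.Finite R (Abelian.Ext (powQuot a 1) (subQuot (powTorsion a M)).X₂ 0) := hM 0
  have : IsNoetherian R (Abelian.Ext (powQuot a 1) (subQuot (powTorsion a M)).X₂ 0) :=
    isNoetherian_of_isNoetherianRing_of_finite R _
  have : Module.Finite R (Abelian.Ext (powQuot a 1) (ModuleCat.of R (powTorsion a M)) 0) :=
    have hS := subQuot_shortExact (powTorsion a M)
    Module.Finite.of_injective (N := Abelian.Ext (powQuot a 1) (subQuot (powTorsion a M)).X₂ 0) _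
      (extMap_zero_injective hS (powQuot a 1))
  exact isMinimax_and_extFinite_of_torsion a exists_pow_smul_eq_zero_of_powTorsion
    (h.of_linearEquiv e)

theorem isMinimax_locCoh (i : ℕ) (M : Type) [AddCommGroup M] [Module R M]
    (hM : ExtFinite (powQuot a 1) (ModuleCat.of R M))
    (h : ∀ j ≤ i, InDimLT R (locCoh R a j M) 1) : IsMinimax R (locCoh R a i M) := by
  induction i generalizing M with
  | zero =>
    obtain ⟨φ, hφ⟩ := exists_isDirLim_locCoh a 0 M
    obtain ⟨e⟩ := hφ.nonempty_equiv (isDirLim_powTorsion a M)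
    exact (isMinimax_and_extFinite_powTorsion a M hM (h 0 le_rfl)).1.of_linearEquiv e.symm
  | succ i ih =>
    have hΓ := (isMinimax_and_extFinite_powTorsion a M hM (h 0 (Nat.zero_le _))).2
    have hM' := ExtFinite.of_shortExact₃ (subQuot_shortExact (powTorsion a M)) hΓ hM
    obtain ⟨C, _, _, hC, hshift⟩ := exists_locCoh_shift a (M ⧸ powTorsion a M)
      powTorsion_quotient_eq_bot hM'
    have e : ∀ j, Nonempty (locCoh R a j C ≃ₗ[R] locCoh R a (j + 1) M) := fun j => by
      obtain ⟨e₁⟩ := hshift j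
      obtain ⟨e₂⟩ := nonempty_locCoh_succ_equiv a M j
      exact ⟨e₁ ≪≫ₗ e₂.symm⟩
    obtain ⟨e'⟩ := e i
    refine (ih C hC fun j hj => ?_).of_linearEquiv e'
    obtain ⟨e''⟩ := e j
    exact (h (j + 1) (Nat.succ_le_succ hj)).of_linearEquiv e''.symm

end DimensionShift

/-- `h_a^1(M)` is the least `i` such that `H^i_a(M)` is not minimax. -/
theorem hDimN_one_eq_inf_not_minimax (R : Type) [CommRing R] [IsNoetherianRing R] (a : Ideal R)
    (M : Type) [AddCommGroup M] [Module R M] [Module.Finite R M] :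
    hDimN R a 1 M = sInf (Nat.cast '' {i : ℕ | ¬ IsMinimax R ↥(locCoh R a i M)}) := by
  refine le_antisymm (sInf_le_sInf_of_isCoinitialFor ?_) (sInf_le_sInf (Set.image_mono ?_))
  · rintro _ ⟨i, hi, rfl⟩
    by_contra! H
    refine hi (isMinimax_locCoh a i M (ExtFinite.of_finite _ _) fun j hj => ?_)
    by_contra hj'
    exact (H _ ⟨j, hj', rfl⟩).not_ge (by exact_mod_cast hj)
  · exact fun i hi h => hi h.inDimLT_one
end
end
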